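/- arXiv:1708.01916 — 7 statements merged into one kernel-verified Lean document; each statement's English description precedes it below -/
import Mathlib

section
/- For n ≥ 7, M_{K_{1,n−1}} > M_{K_{2,n−2}}; and for n ≥ 6 and every s with 2 ≤ s ≤ ⌊n/2⌋ − 1, M_{K_{s,n−s}} > M_{K_{s+1,n−s−1}}. In particular, among all complete bipartite graphs of order n ≥ 7, the star K_{1,n−1} has maximum global mean. -/
open SimpleGraph Finset

/-- The collection of nonempty vertex subsets inducing a connected subgraph. -/
noncomputable def connSets {V : Type*} [Fintype V] (G : SimpleGraph V) : Finset (Finset V) :=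
  (Set.toFinite {S : Finset V | S.Nonempty ∧ (G.induce (S : Set V)).Connected}).toFinset

/-- The global mean `M_G`: the average cardinality of the nonempty vertex subsets
inducing a connected subgraph. -/
noncomputable def globalMean {V : Type*} [Fintype V] (G : SimpleGraph V) : ℝ :=
  (∑ S ∈ connSets G, (S.card : ℝ)) / ((connSets G).card : ℝ)

/-- The collection of vertex subsets containing `v` and inducing a connected subgraph. -/
noncomputable def localSets {V : Type*} [Fintype V] (G : SimpleGraph V) (v : V) :
    Finset (Finset V) :=
  (Set.toFinite {S : Finset V | v ∈ S ∧ (G.induce (S : Set V)).Connected}).toFinset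

/-- The local mean `M_{G,v}`: the average cardinality of the vertex subsets containing `v`
and inducing a connected subgraph. -/
noncomputable def localMean {V : Type*} [Fintype V] (G : SimpleGraph V) (v : V) : ℝ :=
  (∑ S ∈ localSets G v, (S.card : ℝ)) / ((localSets G v).card : ℝ)

/-- The collection of vertex subsets of size at least `2` inducing a connected subgraph. -/
noncomputable def mstarSets {V : Type*} [Fintype V] (G : SimpleGraph V) : Finset (Finset V) :=
  (Set.toFinite {S : Finset V | 2 ≤ S.card ∧ (G.induce (S : Set V)).Connected}).toFinset

/-- The `M*` mean `M*_G`: the average cardinality of the vertex subsets of size at least `2`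
inducing a connected subgraph (it equals `0` if there are no such subsets, by the
`0/0 = 0` convention of real division). -/
noncomputable def mstarMean {V : Type*} [Fintype V] (G : SimpleGraph V) : ℝ :=
  (∑ S ∈ mstarSets G, (S.card : ℝ)) / ((mstarSets G).card : ℝ)

/-- A cograph is a graph with no induced subgraph isomorphic to the path on 4 vertices. -/
def IsCograph {V : Type*} (G : SimpleGraph V) : Prop :=
  IsEmpty (SimpleGraph.pathGraph 4 ↪g G)

/-- The `n`-skillet `S_n = K_1 + (K_1 ∪ K_{n-2})`: vertex `0` is adjacent to all other
vertices, vertex `1` is adjacent only to vertex `0`, and the vertices `2, …, n-1` form a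
clique, each also adjacent to vertex `0`. -/
def skillet (n : ℕ) : SimpleGraph (Fin n) :=
  SimpleGraph.fromRel (fun i j => (i : ℕ) = 0 ∨ (2 ≤ (i : ℕ) ∧ 2 ≤ (j : ℕ)))

lemma two_sum_card (s : ℕ) : 2 * ∑ A : Finset (Fin s), (A.card : ℝ) = s * 2 ^ s := by
  have h : ∑ A : Finset (Fin s), (A.card : ℝ) = ∑ A : Finset (Fin s), ((s : ℝ) - A.card) := by
    rw [← Equiv.sum_comp (Equiv.mk (fun A : Finset (Fin s) => Aᶜ) (fun A => Aᶜ)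
      (fun A => compl_compl A) (fun A => compl_compl A))]
    refine Finset.sum_congr rfl fun A _ => ?_
    simp only [Equiv.coe_fn_mk]
    rw [Finset.card_compl, Nat.cast_sub (Finset.card_le_univ A)]
    simp
  rw [Finset.sum_sub_distrib] at h
  simp at h
  linarith

lemma conn_iff {s t : ℕ} (A : Finset (Fin s)) (B : Finset (Fin t)) (hA : A.Nonempty)
    (hB : B.Nonempty) :
    ((completeBipartiteGraph (Fin s) (Fin t)).induce
      ((A.disjSum B : Finset _) : Set (Fin s ⊕ Fin t))).Connected := by
  obtain ⟨a, ha⟩ := hA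
  obtain ⟨b, hb⟩ := hB
  have ha' : Sum.inl a ∈ ((A.disjSum B : Finset _) : Set (Fin s ⊕ Fin t)) := by simpa using ha
  have hb' : Sum.inr b ∈ ((A.disjSum B : Finset _) : Set (Fin s ⊕ Fin t)) := by simpa using hb
  rw [SimpleGraph.connected_iff_exists_forall_reachable]
  refine ⟨⟨_, ha'⟩, ?_⟩
  have hab : ((completeBipartiteGraph (Fin s) (Fin t)).induce
      ((A.disjSum B : Finset _) : Set (Fin s ⊕ Fin t))).Adj ⟨_, ha'⟩ ⟨_, hb'⟩ := by
    simp
  rintro ⟨x | x, hx⟩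
  · refine hab.reachable.trans (SimpleGraph.Adj.reachable ?_)
    simp
  · apply SimpleGraph.Adj.reachable
    simp

lemma conn_same {V : Type*} (G : SimpleGraph V) (S : Finset V)
    (h : (G.induce (S : Set V)).Connected) (hn : ∀ x ∈ S, ∀ y ∈ S, ¬ G.Adj x y) :
    ∃ v, S = {v} := by
  obtain ⟨⟨v, hv⟩⟩ := h.nonempty
  refine ⟨v, ?_⟩
  have hbot : G.induce (S : Set V) = ⊥ := by
    ext x y
    simpa using hn x x.2 y y.2
  ext w
  simp only [Finset.mem_singleton]
  constructor
  · intro hw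
    have := h.preconnected ⟨w, hw⟩ ⟨v, hv⟩
    rw [hbot, SimpleGraph.reachable_bot] at this
    exact congrArg Subtype.val this
  · rintro rfl
    exact hv

lemma connSets_eq (s t : ℕ) : connSets (completeBipartiteGraph (Fin s) (Fin t)) =
    ((univ.erase (∅ : Finset (Fin s)) ×ˢ univ.erase (∅ : Finset (Fin t))).image
      (fun p => p.1.disjSum p.2)) ∪ univ.image (fun v => {v}) := by
  ext S
  simp only [connSets, Set.Finite.mem_toFinset, Set.mem_setOf_eq, Finset.mem_union,
    Finset.mem_image, Finset.mem_product, Finset.mem_erase, Finset.mem_univ, and_true, true_and]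
  constructor
  · rintro ⟨-, h⟩
    by_cases hA : S.toLeft = ∅
    · right
      obtain ⟨v, hv⟩ := conn_same _ S h (by
        rintro (x | x) hx (y | y) hy
        · simp
        · have := Finset.mem_toLeft.2 hx
          simp [hA] at this
        · have := Finset.mem_toLeft.2 hy
          simp [hA] at this
        · simp)
      exact ⟨v, hv.symm⟩
    by_cases hB : S.toRight = ∅
    · right
      obtain ⟨v, hv⟩ := conn_same _ S h (by
        rintro (x | x) hx (y | y) hy
        · simp
        · have := Finset.mem_toRight.2 hy
          simp [hB] at this
        · have := Finset.mem_toRight.2 hx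
          simp [hB] at this
        · simp)
      exact ⟨v, hv.symm⟩
    left
    exact ⟨(S.toLeft, S.toRight), ⟨hA, hB⟩, Finset.toLeft_disjSum_toRight⟩
  · rintro (⟨⟨A, B⟩, ⟨hA, hB⟩, rfl⟩ | ⟨v, rfl⟩)
    · have hA' := Finset.nonempty_iff_ne_empty.2 hA
      have hB' := Finset.nonempty_iff_ne_empty.2 hB
      refine ⟨?_, conn_iff A B hA' hB'⟩
      obtain ⟨a, ha⟩ := hA'
      exact ⟨Sum.inl a, by simpa using ha⟩
    · refine ⟨by simp, ?_⟩
      rw [SimpleGraph.connected_iff_exists_forall_reachable]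
      refine ⟨⟨v, by simp⟩, ?_⟩
      rintro ⟨w, hw⟩
      have : w = v := by simpa using hw
      subst this
      exact SimpleGraph.Reachable.refl _

lemma sum_connSets (s t : ℕ) (f : ℕ → ℝ) :
    ∑ S ∈ connSets (completeBipartiteGraph (Fin s) (Fin t)), f S.card =
    (∑ A ∈ univ.erase (∅ : Finset (Fin s)), ∑ B ∈ univ.erase (∅ : Finset (Fin t)),
      f (A.card + B.card)) + (s + t) * f 1 := by
  rw [connSets_eq, Finset.sum_union, Finset.sum_image, Finset.sum_image, Finset.sum_product]
  · simp
  · intro a _ b _ h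
    simpa using h
  · rintro ⟨a, b⟩ _ ⟨c, d⟩ _ h
    have h1 := congrArg Finset.toLeft h
    have h2 := congrArg Finset.toRight h
    simp at h1 h2
    simp [h1, h2]
  · rw [Finset.disjoint_left]
    intro S h1 h2
    simp only [Finset.mem_image, Finset.mem_product, Finset.mem_erase, Finset.mem_univ,
      and_true, true_and] at h1 h2
    obtain ⟨⟨A, B⟩, ⟨hA, hB⟩, rfl⟩ := h1
    obtain ⟨v, hv⟩ := h2
    have h3 := congrArg Finset.card hv
    rw [Finset.card_disjSum, Finset.card_singleton] at h3
    have := Finset.card_pos.2 (Finset.nonempty_iff_ne_empty.2 hA)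
    have := Finset.card_pos.2 (Finset.nonempty_iff_ne_empty.2 hB)
    dsimp only at *
    omega

noncomputable def Dn (s t : ℕ) : ℝ := 2 ^ s * 2 ^ t - 2 ^ s - 2 ^ t + s + t + 1
noncomputable def Nn (s t : ℕ) : ℝ := (s + t) - (s + t) ^ 2 + t * 2 ^ s + s * 2 ^ t

lemma card_conn (s t : ℕ) :
    ((connSets (completeBipartiteGraph (Fin s) (Fin t))).card : ℝ) = Dn s t := by
  have h := sum_connSets s t (fun _ => 1)
  have e (k : ℕ) : (((univ.erase (∅ : Finset (Fin k))).card : ℕ) : ℝ) = 2 ^ k - 1 := by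
    rw [Finset.card_erase_of_mem (by simp), Nat.cast_sub (by simp [Nat.one_le_two_pow])]
    simp
  simp only [Finset.sum_const, nsmul_eq_mul, e, mul_one] at h
  rw [h, Dn]; ring

lemma sum_conn (s t : ℕ) :
    2 * ∑ S ∈ connSets (completeBipartiteGraph (Fin s) (Fin t)), (S.card : ℝ)
      = Nn s t + (s + t) * Dn s t := by
  have h := sum_connSets s t (fun k => (k : ℝ))
  have e (k : ℕ) : (((univ.erase (∅ : Finset (Fin k))).card : ℕ) : ℝ) = 2 ^ k - 1 := by
    rw [Finset.card_erase_of_mem (by simp), Nat.cast_sub (by simp [Nat.one_le_two_pow])]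
    simp
  have e2 (k : ℕ) : ∑ A ∈ univ.erase (∅ : Finset (Fin k)), (A.card : ℝ) = k * 2 ^ k / 2 := by
    rw [Finset.sum_erase _ (by simp)]
    linarith [two_sum_card k]
  simp only [Nat.cast_add, Finset.sum_add_distrib, Finset.sum_const, nsmul_eq_mul, e,
    ← Finset.mul_sum, e2] at h
  rw [h, Dn, Nn]; push_cast; ring

lemma Dn_pos (s t : ℕ) (hs : 1 ≤ s) : 0 < Dn s t := by
  have h1 : (1 : ℝ) ≤ 2 ^ s := one_le_pow₀ (by norm_num)
  have h2 : (1 : ℝ) ≤ 2 ^ t := one_le_pow₀ (by norm_num)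
  have h3 : (1 : ℝ) ≤ s := by exact_mod_cast hs
  have h4 : (0 : ℝ) ≤ t := by positivity
  unfold Dn
  nlinarith

lemma globalMean_eq (s t : ℕ) (h : 1 ≤ s) :
    globalMean (completeBipartiteGraph (Fin s) (Fin t)) = Nn s t / Dn s t / 2 + (s + t) / 2 := by
  have := Dn_pos s t h
  rw [globalMean, card_conn]
  field_simp
  linarith [sum_conn s t]

lemma globalMean_symm (s t : ℕ) (h : 1 ≤ s) (h' : 1 ≤ t) :
    globalMean (completeBipartiteGraph (Fin s) (Fin t)) =
    globalMean (completeBipartiteGraph (Fin t) (Fin s)) := by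
  rw [globalMean_eq s t h, globalMean_eq t s h']
  have : Nn s t = Nn t s := by unfold Nn; ring
  have : Dn s t = Dn t s := by unfold Dn; ring
  simp only [*]; ring

lemma pow_ge (t : ℕ) (h : 4 ≤ t) : (t : ℝ) ^ 2 ≤ 2 ^ t := by
  induction t, h using Nat.le_induction with
  | base => norm_num
  | succ n hn ih =>
    have : (4 : ℝ) ≤ n := by exact_mod_cast hn
    rw [pow_succ (2 : ℝ)]; push_cast; nlinarith

lemma pow_ge1 (t : ℕ) (h : 2 ≤ t) : (t : ℝ) + 2 ≤ 2 ^ t := by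
  induction t, h using Nat.le_induction with
  | base => norm_num
  | succ n hn ih =>
    have : (2 : ℝ) ≤ n := by exact_mod_cast hn
    rw [pow_succ (2 : ℝ)]; push_cast; nlinarith

lemma pow_ge2 (t : ℕ) (h : 7 ≤ t) : ((t : ℝ) + 3) * (t - 2) < 2 ^ (t - 1) := by
  induction t, h using Nat.le_induction with
  | base => norm_num
  | succ n hn ih =>
    have : (7 : ℝ) ≤ n := by exact_mod_cast hn
    have e : n + 1 - 1 = (n - 1) + 1 := by omega
    rw [e, pow_succ (2 : ℝ)]; push_cast; nlinarith

lemma pow_ge3 (k : ℕ) : (k : ℝ) + 1 ≤ 2 ^ k := by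
  exact_mod_cast Nat.lt_two_pow_self

lemma step1 (m : ℕ) (h : 5 ≤ m) :
    globalMean (completeBipartiteGraph (Fin 2) (Fin m)) <
    globalMean (completeBipartiteGraph (Fin 1) (Fin (m + 1))) := by
  rw [globalMean_eq _ _ (by norm_num), globalMean_eq _ _ (by norm_num)]
  have key : Nn 2 m / Dn 2 m < Nn 1 (m + 1) / Dn 1 (m + 1) := by
    rw [div_lt_div_iff₀ (Dn_pos _ _ (by norm_num)) (Dn_pos _ _ (by norm_num))]
    have h1 := pow_ge2 (m + 2) (by omega)
    have e : m + 2 - 1 = m + 1 := by omega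
    rw [e, pow_succ] at h1
    have hm : (5 : ℝ) ≤ m := by exact_mod_cast h
    unfold Nn Dn
    push_cast at h1 ⊢
    rw [pow_succ (2 : ℝ) m]
    have hx : (0 : ℝ) < 2 ^ m := by positivity
    generalize (2 : ℝ) ^ m = x at *
    have := mul_pos hx (sub_pos.2 h1)
    nlinarith
  push_cast
  linarith

lemma step2 (s k : ℕ) (hs : 2 ≤ s) :
    globalMean (completeBipartiteGraph (Fin (s + 1)) (Fin (s + k + 1))) <
    globalMean (completeBipartiteGraph (Fin s) (Fin (s + k + 2))) := by
  rw [globalMean_eq _ _ (by omega), globalMean_eq _ _ (by omega)]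
  have hs' : (2 : ℝ) ≤ s := by exact_mod_cast hs
  have hk' : (0 : ℝ) ≤ k := by positivity
  have hx := pow_ge1 s hs
  have hy := pow_ge3 k
  have ht := pow_ge (s + k + 2) (by omega)
  have hN : 0 < Nn s (s + k + 2) := by
    unfold Nn
    have h1 := mul_le_mul_of_nonneg_left hx (by positivity : (0 : ℝ) ≤ s + k + 2)
    have h2 := mul_le_mul_of_nonneg_left ht (by positivity : (0 : ℝ) ≤ s)
    push_cast at h1 h2 ⊢
    have h3 : (0 : ℝ) < (s + k + 2) * (s + 2) + s * (s + k + 2) ^ 2 + (s + (s + k + 2))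
        - (s + (s + k + 2)) ^ 2 := by
      obtain ⟨a, ha⟩ : ∃ a : ℝ, a = s - 2 := ⟨_, rfl⟩
      have ha' : 0 ≤ a := by linarith
      have : (s : ℝ) = a + 2 := by linarith
      rw [this]
      ring_nf
      positivity
    linarith
  have hNN : Nn (s + 1) (s + k + 1) ≤ Nn s (s + k + 2) := by
    have : 0 ≤ 2 ^ s * (2 * 2 ^ k * ((s : ℝ) - 1) - (s + k)) := by
      apply mul_nonneg (by positivity)
      have := mul_le_mul_of_nonneg_right hy (by linarith : (0 : ℝ) ≤ s - 1)
      nlinarith [mul_nonneg hk' (by linarith : (0 : ℝ) ≤ s - 2)]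
    unfold Nn
    push_cast
    simp only [pow_add]
    linarith
  have hDD : Dn s (s + k + 2) < Dn (s + 1) (s + k + 1) := by
    have : 0 < 2 ^ s * (2 * (2 : ℝ) ^ k - 1) := by
      apply mul_pos (by positivity)
      linarith
    unfold Dn
    push_cast
    simp only [pow_add]
    linarith
  have hD := Dn_pos s (s + k + 2) (by omega)
  have key : Nn (s + 1) (s + k + 1) / Dn (s + 1) (s + k + 1)
      < Nn s (s + k + 2) / Dn s (s + k + 2) :=
    calc _ ≤ Nn s (s + k + 2) / Dn (s + 1) (s + k + 1) :=
          div_le_div_of_nonneg_right hNN (hD.trans hDD).le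
      _ < _ := div_lt_div_of_pos_left hN hD hDD
  push_cast
  linarith

lemma star_max (n s : ℕ) (hn : 7 ≤ n) (hs : 1 ≤ s) (h2 : 2 * s ≤ n) :
    globalMean (completeBipartiteGraph (Fin s) (Fin (n - s))) ≤
        globalMean (completeBipartiteGraph (Fin 1) (Fin (n - 1))) := by
  induction s, hs using Nat.le_induction with
  | base => exact le_rfl
  | succ s hs ih =>
    refine le_trans (le_of_lt ?_) (ih (by omega))
    rcases Nat.eq_or_lt_of_le hs with rfl | h
    · obtain ⟨m, rfl⟩ := Nat.exists_eq_add_of_le hn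
      have e := step1 (m + 5) (by omega)
      have e1 : 7 + m - (1 + 1) = m + 5 := by omega
      have e2 : 7 + m - 1 = m + 5 + 1 := by omega
      rw [e1, e2]
      exact e
    · obtain ⟨k, rfl⟩ := Nat.exists_eq_add_of_le h2
      have e := step2 s k h
      have e1 : 2 * (s + 1) + k - (s + 1) = s + k + 1 := by omega
      have e2 : 2 * (s + 1) + k - s = s + k + 2 := by omega
      rw [e1, e2]
      exact e

theorem stmt_6 :
    (∀ n : ℕ, 7 ≤ n →
      globalMean (completeBipartiteGraph (Fin 1) (Fin (n - 1))) >
        globalMean (completeBipartiteGraph (Fin 2) (Fin (n - 2)))) ∧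
    (∀ n s : ℕ, 6 ≤ n → 2 ≤ s → s ≤ n / 2 - 1 →
      globalMean (completeBipartiteGraph (Fin s) (Fin (n - s))) >
        globalMean (completeBipartiteGraph (Fin (s + 1)) (Fin (n - s - 1)))) ∧
    (∀ n s : ℕ, 7 ≤ n → 1 ≤ s → s ≤ n - 1 →
      globalMean (completeBipartiteGraph (Fin s) (Fin (n - s))) ≤
        globalMean (completeBipartiteGraph (Fin 1) (Fin (n - 1)))) := by
  refine ⟨fun n hn => ?_, fun n s hn hs h => ?_, fun n s hn hs h => ?_⟩
  · obtain ⟨m, rfl⟩ := Nat.exists_eq_add_of_le hn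
    have e := step1 (m + 5) (by omega)
    have e1 : 7 + m - 2 = m + 5 := by omega
    have e2 : 7 + m - 1 = m + 5 + 1 := by omega
    rw [e1, e2]
    exact e
  · have h2 : 2 * (s + 1) ≤ n := by omega
    obtain ⟨k, rfl⟩ := Nat.exists_eq_add_of_le h2
    have e := step2 s k hs
    have e1 : 2 * (s + 1) + k - s - 1 = s + k + 1 := by omega
    have e2 : 2 * (s + 1) + k - s = s + k + 2 := by omega
    rw [e1, e2]
    exact e
  · by_cases h2 : 2 * s ≤ n
    · exact star_max n s hn hs h2
    · have e := star_max n (n - s) hn (by omega) (by omega)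
      have e1 : n - (n - s) = s := by omega
      rw [e1] at e
      rw [globalMean_symm s (n - s) hs (by omega)]
      exact e
end

section
/- The sequence M*_{K_{1,n−1}} is strictly increasing in n for n ≥ 1. Moreover, (n+1)/2 < M*_{K_{1,n−1}} ≤ (n+2)/2 for all n ≥ 2. -/
open SimpleGraph Finset

def starSet (k : ℕ) : Finset (Fin k) ↪ Finset (Fin 1 ⊕ Fin k) where
  toFun T := Finset.disjSum Finset.univ T
  inj' := by
    intro A B h
    ext x
    have := congrArg (fun S => Sum.inr x ∈ S) h
    simpa using this

lemma starSet_card (k : ℕ) (T : Finset (Fin k)) : (starSet k T).card = 1 + T.card := by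
  change (Finset.disjSum Finset.univ T).card = _
  simp

lemma star_conn (k : ℕ) (S : Finset (Fin 1 ⊕ Fin k)) (h : Sum.inl 0 ∈ S) :
    ((completeBipartiteGraph (Fin 1) (Fin k)).induce (S : Set (Fin 1 ⊕ Fin k))).Connected := by
  rw [SimpleGraph.connected_iff_exists_forall_reachable]
  refine ⟨⟨Sum.inl 0, by simpa using h⟩, ?_⟩
  rintro ⟨w, hw⟩
  rcases w with w | w
  · have : w = 0 := Subsingleton.elim _ _
    subst this
    exact SimpleGraph.Reachable.refl _
  · apply SimpleGraph.Adj.reachable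
    simp

lemma star_conn_conv (k : ℕ) (S : Finset (Fin 1 ⊕ Fin k)) (h2 : 2 ≤ S.card)
    (hc : ((completeBipartiteGraph (Fin 1) (Fin k)).induce (S : Set (Fin 1 ⊕ Fin k))).Connected) :
    Sum.inl 0 ∈ S := by
  have : 1 < S.card := h2
  rw [Finset.one_lt_card] at this
  obtain ⟨a, ha, b, hb, hab⟩ := this
  have : Nontrivial ((S : Set (Fin 1 ⊕ Fin k))) :=
    ⟨⟨a, by simpa using ha⟩, ⟨b, by simpa using hb⟩, by simpa using hab⟩
  obtain ⟨⟨c, hc'⟩, hadj⟩ := hc.preconnected.exists_adj_of_nontrivial ⟨a, by simpa using ha⟩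
  rcases a with a | a
  · have : a = 0 := Subsingleton.elim _ _
    subst this
    exact ha
  · rcases c with c | c
    · have : c = 0 := Subsingleton.elim _ _
      subst this
      simpa using hc'
    · simp at hadj

lemma mstarSets_star (k : ℕ) : mstarSets (completeBipartiteGraph (Fin 1) (Fin k)) =
    ((Finset.univ : Finset (Finset (Fin k))).erase ∅).map (starSet k) := by
  ext S
  simp only [mstarSets, Set.Finite.mem_toFinset, Set.mem_setOf_eq, Finset.mem_map,
    Finset.mem_erase, Finset.mem_univ, and_true]
  constructor
  · rintro ⟨h2, hc⟩
    have h0 := star_conn_conv k S h2 hc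
    have hS : starSet k S.toRight = S := by
      ext x
      rcases x with x | x
      · have : x = 0 := Subsingleton.elim _ _
        subst this
        simpa [starSet] using h0
      · simp [starSet]
    refine ⟨S.toRight, ?_, hS⟩
    intro h
    rw [← hS, h] at h2
    simp [starSet] at h2
  · rintro ⟨T, hT, rfl⟩
    refine ⟨?_, star_conn k _ (by simp [starSet])⟩
    have := Finset.card_pos.2 (Finset.nonempty_iff_ne_empty.2 hT)
    rw [starSet_card]
    omega

lemma sum_card_real (k : ℕ) : ∑ T : Finset (Fin k), (T.card : ℝ) = k * 2 ^ k / 2 := by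
  have h : ∑ T : Finset (Fin k), (T.card : ℝ) = ∑ T : Finset (Fin k), ((k : ℝ) - T.card) := by
    refine Finset.sum_bij' (fun T _ => Tᶜ) (fun T _ => Tᶜ) (by simp) (by simp) (by simp) (by simp) ?_
    intro T _
    have := Finset.card_add_card_compl T
    rw [Fintype.card_fin] at this
    have h2 : (T.card : ℝ) + (Tᶜ.card : ℝ) = k := by exact_mod_cast this
    linarith
  rw [Finset.sum_sub_distrib] at h
  simp at h
  linarith

lemma mstar_star (k : ℕ) : mstarMean (completeBipartiteGraph (Fin 1) (Fin k)) =
    ((2 ^ k - 1) + k * 2 ^ k / 2) / (2 ^ k - 1) := by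
  have hcard : (((Finset.univ : Finset (Finset (Fin k))).erase ∅).card : ℝ) = 2 ^ k - 1 := by
    rw [Finset.cast_card_erase_of_mem (Finset.mem_univ _)]
    simp
  rw [mstarMean, mstarSets_star, Finset.card_map, Finset.sum_map, hcard]
  congr 1
  simp only [starSet_card, Nat.cast_add, Nat.cast_one, Finset.sum_add_distrib]
  rw [Finset.sum_const, nsmul_eq_mul, hcard, mul_one]
  congr 1
  rw [← sum_card_real]
  exact Finset.sum_erase _ (by simp)

lemma star_bounds (k : ℕ) (hk : 1 ≤ k) :
    ((k : ℝ) + 2) / 2 < mstarMean (completeBipartiteGraph (Fin 1) (Fin k)) ∧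
    mstarMean (completeBipartiteGraph (Fin 1) (Fin k)) ≤ ((k : ℝ) + 3) / 2 := by
  have h1 : ((k : ℝ) + 1) ≤ 2 ^ k := by exact_mod_cast (Nat.lt_two_pow_self (n := k))
  have h2 : (1 : ℝ) ≤ k := by exact_mod_cast hk
  have h3 : (0 : ℝ) < 2 ^ k - 1 := by linarith
  rw [mstar_star, lt_div_iff₀ h3, div_le_iff₀ h3]
  constructor <;> nlinarith

theorem stmt_7 :
    (∀ m n : ℕ, 1 ≤ m → m < n →
      mstarMean (completeBipartiteGraph (Fin 1) (Fin (m - 1))) <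
        mstarMean (completeBipartiteGraph (Fin 1) (Fin (n - 1)))) ∧
    (∀ n : ℕ, 2 ≤ n →
      ((n : ℝ) + 1) / 2 < mstarMean (completeBipartiteGraph (Fin 1) (Fin (n - 1))) ∧
        mstarMean (completeBipartiteGraph (Fin 1) (Fin (n - 1))) ≤ ((n : ℝ) + 2) / 2) := by
  constructor
  · intro m n hm hmn
    obtain ⟨a, rfl⟩ : ∃ a, m = a + 1 := ⟨m - 1, by omega⟩
    obtain ⟨b, rfl⟩ : ∃ b, n = b + 1 := ⟨n - 1, by omega⟩
    change mstarMean (completeBipartiteGraph (Fin 1) (Fin a)) <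
      mstarMean (completeBipartiteGraph (Fin 1) (Fin b))
    have hb := (star_bounds b (by omega)).1
    have hab : (a : ℝ) + 1 ≤ b := by exact_mod_cast (show a + 1 ≤ b by omega)
    rcases Nat.eq_zero_or_pos a with rfl | ha
    · have h0 : mstarMean (completeBipartiteGraph (Fin 1) (Fin 0)) = 0 := by
        rw [mstar_star]; simp
      rw [h0]
      have : (0 : ℝ) ≤ b := by positivity
      linarith
    · have := (star_bounds a ha).2
      linarith
  · intro n hn
    obtain ⟨b, rfl⟩ : ∃ b, n = b + 1 := ⟨n - 1, by omega⟩
    change (((b + 1 : ℕ) : ℝ) + 1) / 2 < mstarMean (completeBipartiteGraph (Fin 1) (Fin b)) ∧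
      mstarMean (completeBipartiteGraph (Fin 1) (Fin b)) ≤ (((b + 1 : ℕ) : ℝ) + 2) / 2
    have := star_bounds b (by omega)
    push_cast
    constructor
    · linarith [this.1]
    · linarith [this.2]
end

section
/- Let G be a cograph (not necessarily connected) of order n ≥ 1. Then M*_G ≤ M*_{K_{1,n−1}}, with equality if and only if G is isomorphic to K_{1,n−1}. -/
open SimpleGraph Finset

noncomputable section StmtHelpers
open Classical

def P4Free {V : Type*} (G : SimpleGraph V) : Prop :=
  ∀ a b c d, G.Adj a b → G.Adj b c → G.Adj c d → ¬ G.Adj a c → ¬ G.Adj b d → ¬ G.Adj a d → False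

theorem p4free_of_cograph {V : Type*} {G : SimpleGraph V} (h : IsCograph G) : P4Free G := by
  intro a b c d hab hbc hcd hac hbd had
  have h1 := hab.ne
  have h2 := hbc.ne
  have h3 := hcd.ne
  have h4 : a ≠ c := by rintro rfl; exact had hcd
  have h5 : b ≠ d := by rintro rfl; exact had hab
  have h6 : a ≠ d := by rintro rfl; exact hbd hab.symm
  refine h.false ⟨⟨![a, b, c, d], ?_⟩, ?_⟩
  · intro i j hij
    fin_cases i <;> fin_cases j <;> simp_all
  · intro i j
    have := hab.symm
    have := hbc.symm
    have := hcd.symm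
    have : ¬ G.Adj c a := fun h => hac h.symm
    have : ¬ G.Adj d b := fun h => hbd h.symm
    have : ¬ G.Adj d a := fun h => had h.symm
    show G.Adj (![a, b, c, d] i) (![a, b, c, d] j) ↔ _
    fin_cases i <;> fin_cases j <;> simp_all [SimpleGraph.pathGraph_adj]

theorem P4Free.compl {V : Type*} {G : SimpleGraph V} (h : P4Free G) : P4Free Gᶜ := by
  intro a b c d hab hbc hcd hac hbd had
  have h4 : a ≠ c := by rintro rfl; exact had hcd
  have h5 : b ≠ d := by rintro rfl; exact had hab
  have h6 : a ≠ d := by rintro rfl; exact hbd hab.symm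
  simp only [SimpleGraph.compl_adj, not_and, not_not] at *
  exact h b d a c (hbd h5) (had h6).symm (hac h4) (fun h => hab.2 h.symm) (fun h => hcd.2 h.symm) hbc.2

/-- `U` splits into two nonempty parts with no edges between them. -/
def Splits0 {V : Type*} (G : SimpleGraph V) (U : Finset V) : Prop :=
  ∃ A ⊆ U, A.Nonempty ∧ (U \ A).Nonempty ∧ ∀ a ∈ A, ∀ b ∈ U \ A, ¬ G.Adj a b

theorem split_step {V : Type*} {G : SimpleGraph V} (h : P4Free G) (U : Finset V) (v : V)
    (hv : v ∉ U) (hs : Splits0 G U) : Splits0 G (insert v U) ∨ Splits0 Gᶜ (insert v U) := by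
  by_cases hall : ∀ x ∈ U, G.Adj v x
  · right
    obtain ⟨A, hA, ⟨a, ha⟩, -, -⟩ := hs
    refine ⟨{v}, by simp, by simp, ⟨a, ?_⟩, ?_⟩
    · have := hA ha
      have : a ≠ v := by rintro rfl; exact hv this
      simp_all
    · intro a ha b hb
      simp only [Finset.mem_singleton] at ha
      subst ha
      simp only [Finset.mem_sdiff, Finset.mem_insert, Finset.mem_singleton] at hb
      have := hall b (by tauto)
      simp [this]
  push Not at hall
  obtain ⟨x, hxU, hx⟩ := hall
  left
  by_contra hno
  -- a closed proper set containing x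
  obtain ⟨A, hAU, hxA, hAne, hA⟩ : ∃ A ⊆ U, x ∈ A ∧ (U \ A).Nonempty ∧
      ∀ a ∈ A, ∀ b ∈ U \ A, ¬ G.Adj a b := by
    obtain ⟨A, hA, h1, h2, h3⟩ := hs
    by_cases hxA : x ∈ A
    · exact ⟨A, hA, hxA, h2, h3⟩
    · refine ⟨U \ A, Finset.sdiff_subset, by simp [hxU, hxA], ?_, ?_⟩
      · rwa [Finset.sdiff_sdiff_eq_self hA]
      · rw [Finset.sdiff_sdiff_eq_self hA]
        intro a ha b hb hab
        exact h3 b hb a ha hab.symm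
  have hex : (A.powerset.filter (fun C => x ∈ C ∧ ∀ a ∈ C, ∀ b ∈ U \ C, ¬ G.Adj a b)).Nonempty :=
    ⟨A, by simp only [Finset.mem_filter, Finset.mem_powerset]; exact ⟨subset_rfl, hxA, hA⟩⟩
  obtain ⟨C, hC, hmin⟩ := Finset.exists_min_image _ Finset.card hex
  simp only [Finset.mem_filter, Finset.mem_powerset] at hC hmin
  obtain ⟨hCA, hxC, hCc⟩ := hC
  have hvC : v ∉ C := fun h => hv (hAU (hCA h))
  -- neighbor of v in C
  obtain ⟨w, hwC, hw⟩ : ∃ w ∈ C, G.Adj v w := by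
    by_contra hcon
    push Not at hcon
    refine hno ⟨C, ?_, ⟨x, hxC⟩, ⟨v, by simp [hvC]⟩, ?_⟩
    · exact (hCA.trans hAU).trans (Finset.subset_insert _ _)
    · intro a ha b hb hab
      simp only [Finset.mem_sdiff, Finset.mem_insert] at hb
      rcases hb with ⟨rfl | hb, hbC⟩
      · exact hcon a ha hab.symm
      · exact hCc a ha b (by simp [hb, hbC]) hab
  obtain ⟨z, hzU, hzC, hz⟩ : ∃ z ∈ U, z ∉ C ∧ G.Adj v z := by
    by_contra hcon
    push Not at hcon
    obtain ⟨q, hq⟩ := hAne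
    simp only [Finset.mem_sdiff] at hq
    refine hno ⟨U \ C, ?_, ⟨q, ?_⟩, ⟨v, by simp [hv]⟩, ?_⟩
    · exact Finset.sdiff_subset.trans (Finset.subset_insert _ _)
    · simp only [Finset.mem_sdiff]; exact ⟨hq.1, fun h => hq.2 (hCA h)⟩
    · intro a ha b hb hab
      simp only [Finset.mem_sdiff, Finset.mem_insert, not_and, not_not] at hb ha
      rcases hb with ⟨rfl | hb, hbC⟩
      · exact hcon a ha.1 ha.2 hab.symm
      · exact hCc b (hbC hb) a (by simp [ha]) hab.symm
  obtain ⟨x', hx'C, hx', y', hy'C, hy', hxy⟩ : ∃ x' ∈ C, ¬ G.Adj v x' ∧ ∃ y' ∈ C, G.Adj v y' ∧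
      G.Adj x' y' := by
    by_contra hcon
    push Not at hcon
    have := hmin (C.filter (fun y => ¬ G.Adj v y)) ⟨(Finset.filter_subset _ _).trans hCA, by
      simp [hxC, hx], by
      intro a ha b hb hab
      simp only [Finset.mem_filter, Finset.mem_sdiff, not_and, not_not] at ha hb
      by_cases hbC : b ∈ C
      · exact hcon a ha.1 ha.2 b hbC (hb.2 hbC) hab
      · exact hCc a ha.1 b (by simp [hb, hbC]) hab⟩
    have h2 : (C.filter (fun y => ¬ G.Adj v y)).card < C.card := by
      apply Finset.card_lt_card
      rw [Finset.filter_ssubset]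
      exact ⟨w, hwC, by simpa using hw⟩
    omega
  have hzm : z ∈ U \ C := by simp [hzU, hzC]
  exact h x' y' v z hxy hy'.symm hz (fun h => hx' h.symm) (hCc _ hy'C _ hzm) (hCc _ hx'C _ hzm)

theorem split_exists {V : Type*} {G : SimpleGraph V} (h : P4Free G) (U : Finset V) :
    2 ≤ U.card → Splits0 G U ∨ Splits0 Gᶜ U := by
  induction U using Finset.induction_on with
  | empty => simp
  | insert v U hv ih =>
    intro hc
    rw [Finset.card_insert_of_notMem hv] at hc
    by_cases h2 : 2 ≤ U.card
    · rcases ih h2 with h1 | h1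
      · exact split_step h U v hv h1
      · have := split_step h.compl U v hv h1
        rw [compl_compl] at this
        exact this.symm
    · obtain ⟨w, rfl⟩ := Finset.card_eq_one.mp (show U.card = 1 by omega)
      have hne : v ≠ w := by simpa using hv
      have hd : ({v, w} : Finset V) \ {v} = {w} := by
        ext t; simp; constructor
        · tauto
        · rintro rfl; exact ⟨Or.inr rfl, hne.symm⟩
      by_cases hadj : G.Adj v w
      · right
        refine ⟨{v}, by simp, by simp, ?_, ?_⟩
        · rw [hd]; simp
        · rw [hd]; simp [hadj]
      · left
        refine ⟨{v}, by simp, by simp, ?_, ?_⟩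
        · rw [hd]; simp
        · rw [hd]; simp [hadj]

/-- connected subsets of `U` of size at least two. -/
def EE {V : Type*} (G : SimpleGraph V) (U : Finset V) : Finset (Finset V) :=
  U.powerset.filter (fun S => 2 ≤ S.card ∧ (G.induce (S : Set V)).Connected)

theorem mem_EE {V : Type*} {G : SimpleGraph V} {U S : Finset V} :
    S ∈ EE G U ↔ S ⊆ U ∧ 2 ≤ S.card ∧ (G.induce (S : Set V)).Connected := by
  simp [EE]

theorem conn_sep {V : Type*} {G : SimpleGraph V} {S A : Finset V}
    (hS : (G.induce (S : Set V)).Connected) (hsep : ∀ a ∈ A, ∀ b ∈ S \ A, ¬ G.Adj a b)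
    {x y : V} (hx : x ∈ S) (hxA : x ∈ A) (hy : y ∈ S) : y ∈ A := by
  by_contra hyA
  obtain ⟨p⟩ := hS.preconnected ⟨x, hx⟩ ⟨y, hy⟩
  obtain ⟨d, -, h1, h2⟩ := p.exists_boundary_dart {z | (z : V) ∈ A} hxA hyA
  exact hsep _ h1 d.snd.1 (by
    have := d.snd.2
    simp only [Finset.mem_sdiff]; exact ⟨by exact_mod_cast this, h2⟩) (by simpa using d.adj)

theorem conn_join {V : Type*} {G : SimpleGraph V} {S A B : Finset V} (hU : S ⊆ A ∪ B)
    (hj : ∀ a ∈ A, ∀ b ∈ B, G.Adj a b) (hA : (S ∩ A).Nonempty) (hB : (S ∩ B).Nonempty) :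
    (G.induce (S : Set V)).Connected := by
  obtain ⟨a, ha⟩ := hA
  obtain ⟨b, hb⟩ := hB
  rw [Finset.mem_inter] at ha hb
  rw [SimpleGraph.connected_iff_exists_forall_reachable]
  refine ⟨⟨a, ha.1⟩, ?_⟩
  have hab : (G.induce (S : Set V)).Adj ⟨a, ha.1⟩ ⟨b, hb.1⟩ := by
    simpa using hj a ha.2 b hb.2
  rintro ⟨w, hw⟩
  have hw' : w ∈ S := by exact_mod_cast hw
  rcases Finset.mem_union.mp (hU hw') with h | h
  · have : (G.induce (S : Set V)).Adj ⟨w, hw⟩ ⟨b, hb.1⟩ := by simpa using hj w h b hb.2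
    exact hab.reachable.trans this.symm.reachable
  · have : (G.induce (S : Set V)).Adj ⟨a, ha.1⟩ ⟨w, hw⟩ := by simpa using hj a ha.2 w h
    exact this.reachable

theorem EE_empty_of_card {V : Type*} {G : SimpleGraph V} {U : Finset V} (h : U.card ≤ 1) :
    EE G U = ∅ := by
  ext S
  simp only [mem_EE, Finset.notMem_empty, iff_false, not_and]
  intro h1 h2
  have := Finset.card_le_card h1
  omega

theorem EE_empty_iff {V : Type*} {G : SimpleGraph V} {U : Finset V} :
    EE G U = ∅ ↔ ∀ x ∈ U, ∀ y ∈ U, ¬ G.Adj x y := by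
  constructor
  · intro h x hx y hy hxy
    have : ({x, y} : Finset V) ∈ EE G U := by
      rw [mem_EE]
      refine ⟨by intro t; simp; rintro (rfl | rfl) <;> assumption, ?_, ?_⟩
      · rw [Finset.card_pair hxy.ne]
      · have := SimpleGraph.induce_pair_connected_of_adj hxy
        rwa [Finset.coe_pair]
    simp [h] at this
  · intro h
    ext S
    simp only [mem_EE, Finset.notMem_empty, iff_false, not_and]
    intro h1 h2 h3
    obtain ⟨x, hx, y, hy, hne⟩ := Finset.one_lt_card.mp (show 1 < S.card by omega)
    have := conn_sep (A := {x}) h3 (by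
      intro a ha b hb
      simp only [Finset.mem_singleton] at ha
      subst ha
      exact h a (h1 hx) b (h1 (Finset.mem_sdiff.mp hb).1)) hx (by simp) hy
    simp at this
    exact hne this.symm

/-- subsets of `A ∪ B` meeting both. -/
def Mixed {V : Type*} (A B : Finset V) : Finset (Finset V) :=
  (A ∪ B).powerset.filter (fun S => (S ∩ A).Nonempty ∧ (S ∩ B).Nonempty)

theorem EE_split {V : Type*} {G : SimpleGraph V} {A B : Finset V} (hd : Disjoint A B)
    (hs : ∀ a ∈ A, ∀ b ∈ B, ¬ G.Adj a b) (w : Finset V → ℝ) :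
    ∑ S ∈ EE G (A ∪ B), w S = ∑ S ∈ EE G A, w S + ∑ S ∈ EE G B, w S := by
  have hdis : Disjoint (EE G A) (EE G B) := by
    rw [Finset.disjoint_left]
    intro S h1 h2
    rw [mem_EE] at h1 h2
    obtain ⟨x, hx⟩ := Finset.card_pos.mp (show 0 < S.card by omega)
    exact Finset.disjoint_left.mp hd (h1.1 hx) (h2.1 hx)
  rw [← Finset.sum_union hdis]
  congr 1
  ext S
  simp only [Finset.mem_union, mem_EE]
  constructor
  · rintro ⟨h1, h2, h3⟩
    by_cases hA : ∃ x ∈ S, x ∈ A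
    · obtain ⟨x, hx, hxA⟩ := hA
      left
      refine ⟨fun y hy => conn_sep h3 ?_ hx hxA hy, h2, h3⟩
      intro a ha b hb
      rw [Finset.mem_sdiff] at hb
      have := h1 hb.1
      simp only [Finset.mem_union] at this
      exact hs a ha b (by tauto)
    · push Not at hA
      right
      refine ⟨fun y hy => ?_, h2, h3⟩
      have := h1 hy
      simp only [Finset.mem_union] at this
      have := hA y hy
      tauto
  · rintro (⟨h1, h2⟩ | ⟨h1, h2⟩)
    · exact ⟨h1.trans Finset.subset_union_left, h2⟩
    · exact ⟨h1.trans Finset.subset_union_right, h2⟩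

theorem EE_join {V : Type*} {G : SimpleGraph V} {A B : Finset V} (hd : Disjoint A B)
    (hs : ∀ a ∈ A, ∀ b ∈ B, G.Adj a b) (w : Finset V → ℝ) :
    ∑ S ∈ EE G (A ∪ B), w S =
      ∑ S ∈ EE G A, w S + ∑ S ∈ EE G B, w S + ∑ S ∈ Mixed A B, w S := by
  have hdd := Finset.disjoint_left.mp hd
  have hdis : Disjoint (EE G A) (EE G B) := by
    rw [Finset.disjoint_left]
    intro S h1 h2
    rw [mem_EE] at h1 h2
    obtain ⟨x, hx⟩ := Finset.card_pos.mp (show 0 < S.card by omega)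
    exact hdd (h1.1 hx) (h2.1 hx)
  have hdis2 : Disjoint (EE G A ∪ EE G B) (Mixed A B) := by
    rw [Finset.disjoint_left]
    intro S h1 h2
    simp only [Finset.mem_union, mem_EE] at h1
    simp only [Mixed, Finset.mem_filter] at h2
    obtain ⟨-, ⟨x, hx⟩, ⟨y, hy⟩⟩ := h2
    rw [Finset.mem_inter] at hx hy
    rcases h1 with h1 | h1
    · exact hdd (h1.1 hy.1) hy.2
    · exact hdd hx.2 (h1.1 hx.1)
  rw [← Finset.sum_union hdis, ← Finset.sum_union hdis2]
  congr 1
  ext S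
  simp only [Finset.mem_union, mem_EE, Mixed, Finset.mem_filter, Finset.mem_powerset]
  constructor
  · rintro ⟨h1, h2⟩
    by_cases hA : (S ∩ A).Nonempty
    · by_cases hB : (S ∩ B).Nonempty
      · exact Or.inr ⟨h1, hA, hB⟩
      · left; left
        refine ⟨fun y hy => ?_, h2⟩
        by_contra hyA
        exact hB ⟨y, by
          have := Finset.mem_union.mp (h1 hy)
          rw [Finset.mem_inter]; tauto⟩
    · left; right
      refine ⟨fun y hy => ?_, h2⟩
      by_contra hyA
      exact hA ⟨y, by
          have := Finset.mem_union.mp (h1 hy)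
          rw [Finset.mem_inter]; tauto⟩
  · rintro ((⟨h1, h2⟩ | ⟨h1, h2⟩) | ⟨h1, h2, h3⟩)
    · exact ⟨h1.trans Finset.subset_union_left, h2⟩
    · exact ⟨h1.trans Finset.subset_union_right, h2⟩
    · refine ⟨h1, ?_, conn_join h1 hs h2 h3⟩
      obtain ⟨x, hx⟩ := h2
      obtain ⟨y, hy⟩ := h3
      rw [Finset.mem_inter] at hx hy
      exact Finset.one_lt_card.mpr ⟨x, hx.1, y, hy.1, fun h => hdd hx.2 (h ▸ hy.2)⟩

theorem Mixed_sum {V : Type*} {A B : Finset V} (hd : Disjoint A B) (w : Finset V → ℝ) :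
    ∑ S ∈ Mixed A B, w S =
      ∑ S ∈ A.powerset.erase ∅, ∑ T ∈ B.powerset.erase ∅, w (S ∪ T) := by
  rw [← Finset.sum_product']
  symm
  have hdd := Finset.disjoint_left.mp hd
  have e1 : ∀ S T : Finset V, S ⊆ A → T ⊆ B → (S ∪ T) ∩ A = S := by
    intro S T h1 h2
    ext x
    have := @hdd x
    have := @h1 x
    have := @h2 x
    simp; tauto
  have e2 : ∀ S T : Finset V, S ⊆ A → T ⊆ B → (S ∪ T) ∩ B = T := by
    intro S T h1 h2
    ext x
    have := @hdd x
    have := @h1 x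
    have := @h2 x
    simp; tauto
  refine Finset.sum_nbij' (fun p => p.1 ∪ p.2) (fun S => (S ∩ A, S ∩ B)) ?_ ?_ ?_ ?_ ?_
  · rintro ⟨S, T⟩ h
    simp only [Finset.mem_product, Finset.mem_erase, Finset.mem_powerset] at h
    simp only [Mixed, Finset.mem_filter, Finset.mem_powerset]
    rw [e1 _ _ h.1.2 h.2.2, e2 _ _ h.1.2 h.2.2]
    exact ⟨Finset.union_subset_union h.1.2 h.2.2, Finset.nonempty_iff_ne_empty.mpr h.1.1,
      Finset.nonempty_iff_ne_empty.mpr h.2.1⟩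
  · intro S h
    simp only [Mixed, Finset.mem_filter, Finset.mem_powerset] at h
    simp only [Finset.mem_product, Finset.mem_erase, Finset.mem_powerset]
    exact ⟨⟨h.2.1.ne_empty, Finset.inter_subset_right⟩, ⟨h.2.2.ne_empty, Finset.inter_subset_right⟩⟩
  · rintro ⟨S, T⟩ h
    simp only [Finset.mem_product, Finset.mem_erase, Finset.mem_powerset] at h
    simp only [e1 _ _ h.1.2 h.2.2, e2 _ _ h.1.2 h.2.2]
  · intro S h
    simp only [Mixed, Finset.mem_filter, Finset.mem_powerset] at h
    simp only
    rw [← Finset.inter_union_distrib_left]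
    exact Finset.inter_eq_left.mpr h.1
  · intro p _
    rfl

theorem card_pe {V : Type*} (A : Finset V) : ((A.powerset.erase ∅).card : ℝ) = 2 ^ A.card - 1 := by
  rw [Finset.card_erase_of_mem (by simp), Finset.card_powerset, Nat.cast_sub Nat.one_le_two_pow]
  simp

theorem sum_pe {V : Type*} (A : Finset V) :
    ∑ S ∈ A.powerset.erase ∅, (S.card : ℝ) = A.card * 2 ^ A.card / 2 := by
  have h0 : ∑ S ∈ A.powerset.erase ∅, (S.card : ℝ) = ∑ S ∈ A.powerset, (S.card : ℝ) := by
    apply Finset.sum_erase; simp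
  rw [h0]
  induction A using Finset.induction_on with
  | empty => simp
  | insert a A ha ih =>
    rw [Finset.sum_powerset_insert ha, ih (Finset.sum_erase _ (by simp)), Finset.card_insert_of_notMem ha]
    have : ∀ S ∈ A.powerset, ((insert a S).card : ℝ) = S.card + 1 := by
      intro S hS
      rw [Finset.card_insert_of_notMem (fun h => ha (Finset.mem_powerset.mp hS h))]
      simp
    rw [Finset.sum_congr rfl this, Finset.sum_add_distrib, ih (Finset.sum_erase _ (by simp))]
    simp only [Finset.sum_const, Finset.card_powerset]
    simp
    ring

def ff (a : ℕ) : ℝ := a / (2 ^ a - 1)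
def hh (m : ℕ) : ℝ := 1 + m / 2 + ff m / 2

theorem two_pow_sub_pos {a : ℕ} (h : 1 ≤ a) : (0 : ℝ) < 2 ^ a - 1 := by
  have : (1 : ℝ) < 2 ^ a := one_lt_pow₀ (by norm_num) (by omega)
  linarith

theorem ff_le {k : ℕ} (p q : ℕ) (hk : 1 ≤ k) (hp : 0 < q) (h0 : q * k + p ≤ p * 2 ^ k) (hpq : q ≤ p * 2 ^ k)
    {b : ℕ} (hb : k ≤ b) : ff b ≤ p / q := by
  have key : q * b + p ≤ p * 2 ^ b ∧ q ≤ p * 2 ^ b := by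
    induction b, hb using Nat.le_induction with
    | base => exact ⟨h0, hpq⟩
    | succ b _ ih => rw [pow_succ]; constructor <;> nlinarith [ih.1, ih.2]
  have h1 : ((q * b + p : ℕ) : ℝ) ≤ ((p * 2 ^ b : ℕ) : ℝ) := by exact_mod_cast key.1
  push_cast at h1
  unfold ff
  rw [div_le_div_iff₀ (two_pow_sub_pos (hk.trans hb)) (by exact_mod_cast hp)]
  linarith

theorem ff_pos {b : ℕ} (hb : 1 ≤ b) : 0 < ff b :=
  div_pos (by exact_mod_cast hb) (two_pow_sub_pos hb)

theorem ff_le_one (b : ℕ) : ff b ≤ 1 := by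
  rcases Nat.eq_zero_or_pos b with rfl | h
  · simp [ff]
  · simpa using ff_le (k := 1) 1 1 le_rfl (by norm_num) (by norm_num) (by norm_num) h

theorem hh_strictMono : StrictMono hh := by
  apply strictMono_nat_of_lt_succ
  intro m
  have h1 := ff_le_one m
  have h2 := ff_pos (b := m + 1) (by omega)
  unfold hh
  push_cast
  linarith

theorem hh_pos (m : ℕ) : 0 < hh m := by
  have := hh_strictMono.monotone (Nat.zero_le m)
  have h0 : hh 0 = 1 := by simp [hh, ff]
  linarith

theorem ff_one : ff 1 = 1 := by norm_num [ff]

theorem ff_two_lt {b : ℕ} (hb : 2 ≤ b) : ff 2 + ff b < 1 + ff (2 + b - 1) := by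
  rcases (show b = 2 ∨ b = 3 ∨ 4 ≤ b by omega) with rfl | rfl | h
  · norm_num [ff]
  · norm_num [ff]
  · have h1 := ff_le (k := 4) 4 15 (by norm_num) (by norm_num) (by norm_num) (by norm_num) h
    have h2 : ff 2 = 2 / 3 := by norm_num [ff]
    have h3 := ff_pos (b := 2 + b - 1) (by omega)
    norm_num at h1
    linarith

theorem ff_lt {a b : ℕ} (ha : 2 ≤ a) (hb : 2 ≤ b) : ff a + ff b < 1 + ff (a + b - 1) := by
  rcases (show a = 2 ∨ b = 2 ∨ (3 ≤ a ∧ 3 ≤ b) by omega) with rfl | rfl | ⟨h1, h2⟩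
  · exact ff_two_lt hb
  · have := ff_two_lt ha
    rw [add_comm, add_comm a]; exact this
  · have h1 := ff_le (k := 3) 3 7 (by norm_num) (by norm_num) (by norm_num) (by norm_num) h1
    have h2 := ff_le (k := 3) 3 7 (by norm_num) (by norm_num) (by norm_num) (by norm_num) h2
    have h3 := ff_pos (b := a + b - 1) (by omega)
    norm_num at h1 h2
    linarith

/-- mean of the mixed sets -/
def gg (a b : ℕ) : ℝ := (a + b) / 2 + (ff a + ff b) / 2

theorem gg_one {b : ℕ} : gg 1 b = hh b := by
  unfold gg hh; rw [ff_one]; push_cast; ring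

theorem gg_comm (a b : ℕ) : gg a b = gg b a := by unfold gg; ring

theorem gg_lt {a b : ℕ} (ha : 2 ≤ a) (hb : 2 ≤ b) : gg a b < hh (a + b - 1) := by
  have := ff_lt ha hb
  unfold gg hh
  rw [Nat.cast_sub (by omega)]
  push_cast
  linarith

theorem gg_le {a b : ℕ} (ha : 1 ≤ a) (hb : 1 ≤ b) : gg a b ≤ hh (a + b - 1) := by
  rcases (show a = 1 ∨ b = 1 ∨ (2 ≤ a ∧ 2 ≤ b) by omega) with rfl | rfl | ⟨h1, h2⟩
  · rw [gg_one]; simp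
  · rw [gg_comm, gg_one]; simp
  · exact (gg_lt h1 h2).le

theorem Mixed_card {V : Type*} {A B : Finset V} (hd : Disjoint A B) :
    ((Mixed A B).card : ℝ) = (2 ^ A.card - 1) * (2 ^ B.card - 1) := by
  have := Mixed_sum hd (fun _ => 1)
  simp only [Finset.sum_const, nsmul_eq_mul, mul_one, card_pe] at this
  exact this

theorem Mixed_total {V : Type*} {A B : Finset V} (hd : Disjoint A B) (hA : 1 ≤ A.card)
    (hB : 1 ≤ B.card) :
    ∑ S ∈ Mixed A B, (S.card : ℝ) = gg A.card B.card * (Mixed A B).card := by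
  rw [Mixed_sum hd, Mixed_card hd]
  have : ∀ S ∈ A.powerset.erase ∅, ∑ T ∈ B.powerset.erase ∅, ((S ∪ T).card : ℝ) =
      S.card * (2 ^ B.card - 1) + B.card * 2 ^ B.card / 2 := by
    intro S hS
    rw [← sum_pe, ← card_pe, mul_comm, ← nsmul_eq_mul, ← Finset.sum_const, ← Finset.sum_add_distrib]
    apply Finset.sum_congr rfl
    intro T hT
    simp only [Finset.mem_erase, Finset.mem_powerset] at hS hT
    rw [Finset.card_union_of_disjoint (Finset.disjoint_of_subset_left hS.2
      (Finset.disjoint_of_subset_right hT.2 hd))]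
    push_cast; ring
  rw [Finset.sum_congr rfl this, Finset.sum_add_distrib, ← Finset.sum_mul, sum_pe,
    Finset.sum_const, nsmul_eq_mul, card_pe]
  have h1 := two_pow_sub_pos hA
  have h2 := two_pow_sub_pos hB
  unfold gg ff
  field_simp
  ring

def StarOn {V : Type*} (G : SimpleGraph V) (U : Finset V) (c : V) : Prop :=
  c ∈ U ∧ ∀ x ∈ U, ∀ y ∈ U, G.Adj x y ↔ (x = c ∧ y ≠ c) ∨ (x ≠ c ∧ y = c)

theorem starOn_of {V : Type*} {G : SimpleGraph V} {A B : Finset V} (hd : Disjoint A B)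
    (hs : ∀ a ∈ A, ∀ b ∈ B, G.Adj a b) (hA : A.card = 1) (hB : EE G B = ∅) :
    ∃ c, StarOn G (A ∪ B) c := by
  obtain ⟨c, rfl⟩ := Finset.card_eq_one.mp hA
  rw [EE_empty_iff] at hB
  refine ⟨c, by simp, ?_⟩
  simp only [Finset.disjoint_singleton_left, Finset.mem_singleton, forall_eq] at hd hs
  intro x hx y hy
  have hxB : x ∈ B → x ≠ c := by rintro h rfl; exact hd h
  have hyB : y ∈ B → y ≠ c := by rintro h rfl; exact hd h
  simp only [Finset.mem_union, Finset.mem_singleton] at hx hy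
  rcases hx with rfl | hx <;> rcases hy with rfl | hy
  · simp
  · simp [hs y hy, hyB hy]
  · simp [(hs x hx).symm, hxB hx]
  · simp [hB x hx y hy, hxB hx, hyB hy]

theorem star_mean {V : Type*} {G : SimpleGraph V} {U : Finset V} {c : V} (h : StarOn G U c)
    (hU : 2 ≤ U.card) : ∑ S ∈ EE G U, (S.card : ℝ) = hh (U.card - 1) * (EE G U).card ∧
      0 < (EE G U).card := by
  obtain ⟨hc, h⟩ := h
  have hcu : U = {c} ∪ U.erase c := by
    rw [← Finset.insert_eq, Finset.insert_erase hc]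
  have hd : Disjoint {c} (U.erase c) := by simp
  have hs : ∀ a ∈ ({c} : Finset V), ∀ b ∈ U.erase c, G.Adj a b := by
    intro a ha b hb
    simp only [Finset.mem_singleton, Finset.mem_erase] at ha hb
    subst ha
    rw [h a hc b hb.2]; simp [hb.1]
  have h1 : EE G {c} = ∅ := EE_empty_of_card (by simp)
  have h2 : EE G (U.erase c) = ∅ := by
    rw [EE_empty_iff]
    intro x hx y hy
    simp only [Finset.mem_erase] at hx hy
    rw [h x hx.2 y hy.2]; simp [hx.1, hy.1]
  have hce : (U.erase c).card = U.card - 1 := Finset.card_erase_of_mem hc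
  have h3 := EE_join hd hs (fun S => (S.card : ℝ))
  have h4 := EE_join hd hs (fun S => (1 : ℝ))
  rw [← hcu, h1, h2, Mixed_total hd (by simp) (by omega)] at h3
  rw [← hcu, h1, h2] at h4
  simp only [Finset.sum_const, nsmul_eq_mul, mul_one, Finset.sum_empty, Finset.card_empty, Nat.cast_zero, zero_add,
    Finset.card_singleton, gg_one, hce] at h3 h4
  rw [h4]
  refine ⟨h3, ?_⟩
  have : (0 : ℝ) < (EE G U).card := by
    rw [h4, Mixed_card hd]
    exact mul_pos (two_pow_sub_pos (Finset.card_singleton c).ge) (two_pow_sub_pos (by rw [hce]; omega))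
  exact_mod_cast this

theorem key {V : Type*} {G : SimpleGraph V} (hG : P4Free G) (n : ℕ) : ∀ U : Finset V, U.card = n →
    ∑ S ∈ EE G U, (S.card : ℝ) ≤ hh (U.card - 1) * (EE G U).card ∧
    (∑ S ∈ EE G U, (S.card : ℝ) = hh (U.card - 1) * (EE G U).card → 0 < (EE G U).card →
      ∃ c, StarOn G U c) := by
  induction n using Nat.strong_induction_on with
  | _ n ih =>
  intro U hU
  by_cases h2 : 2 ≤ U.card
  swap
  · rw [EE_empty_of_card (by omega)]; simp
  have main : ∀ A B : Finset V, Disjoint A B → A ∪ B = U → A.Nonempty → B.Nonempty →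
      (∑ S ∈ EE G A, (S.card : ℝ) ≤ hh (U.card - 1) * (EE G A).card ∧
       (∑ S ∈ EE G A, (S.card : ℝ) = hh (U.card - 1) * (EE G A).card → EE G A = ∅)) := by
    intro A B hd hAB hA hB
    have hc : A.card + B.card = U.card := by rw [← hAB, Finset.card_union_of_disjoint hd]
    have := hA.card_pos
    have := hB.card_pos
    have h1 := (ih A.card (by omega) A rfl).1
    have hlt : hh (A.card - 1) < hh (U.card - 1) := hh_strictMono (by omega)
    have hnn : (0 : ℝ) ≤ (EE G A).card := Nat.cast_nonneg _
    refine ⟨by nlinarith, fun he => ?_⟩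
    by_contra hne
    have : (0 : ℝ) < (EE G A).card := by exact_mod_cast Finset.card_pos.mpr (Finset.nonempty_iff_ne_empty.mpr hne)
    nlinarith
  rcases split_exists hG U h2 with ⟨A, hAU, hA, hB, hs⟩ | ⟨A, hAU, hA, hB, hs⟩
  all_goals
    generalize hBdef : U \ A = B at *
    have hd : Disjoint A B := by rw [← hBdef]; exact Finset.disjoint_sdiff
    have hAB : A ∪ B = U := by rw [← hBdef]; exact Finset.union_sdiff_of_subset hAU
    have mA := main A B hd hAB hA hB
    have mB := main B A hd.symm (by rw [Finset.union_comm, hAB]) hB hA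
    have hc : A.card + B.card = U.card := by rw [← hAB, Finset.card_union_of_disjoint hd]
    have hA1 := hA.card_pos
    have hB1 := hB.card_pos
  · have t := EE_split hd hs (fun S => (S.card : ℝ))
    have c := EE_split hd hs (fun S => (1 : ℝ))
    rw [hAB] at t c
    simp only [Finset.sum_const, nsmul_eq_mul, mul_one] at c
    rw [t, c, mul_add]
    refine ⟨add_le_add mA.1 mB.1, fun he hpos => ?_⟩
    exfalso
    have hEA := mA.2 (by linarith [mA.1, mB.1])
    have hEB := mB.2 (by linarith [mA.1, mB.1])
    rw [hEA, hEB] at c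
    simp at c
    simp [c] at hpos
  · have hs' : ∀ a ∈ A, ∀ b ∈ B, G.Adj a b := by
      intro a ha b hb
      have := hs a ha b hb
      have hne : a ≠ b := by rintro rfl; exact Finset.disjoint_left.mp hd ha hb
      simpa [SimpleGraph.compl_adj, hne] using this
    have t := EE_join hd hs' (fun S => (S.card : ℝ))
    have c := EE_join hd hs' (fun S => (1 : ℝ))
    rw [hAB] at t c
    simp only [Finset.sum_const, nsmul_eq_mul, mul_one] at c
    rw [Mixed_total hd hA1 hB1] at t
    have hM : (0 : ℝ) < (Mixed A B).card := by
      rw [Mixed_card hd]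
      exact mul_pos (two_pow_sub_pos hA1) (two_pow_sub_pos hB1)
    have hg := gg_le (a := A.card) (b := B.card) hA1 hB1
    rw [hc] at hg
    have hgM := mul_le_mul_of_nonneg_right hg hM.le
    rw [t, c, mul_add, mul_add]
    refine ⟨add_le_add (add_le_add mA.1 mB.1) hgM, fun he hpos => ?_⟩
    have hEA := mA.2 (by linarith [mA.1, mB.1])
    have hEB := mB.2 (by linarith [mA.1, mB.1])
    have hge : gg A.card B.card = hh (U.card - 1) := by
      have : gg A.card B.card * (Mixed A B).card = hh (U.card - 1) * (Mixed A B).card := by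
        linarith [mA.1, mB.1]
      exact mul_right_cancel₀ hM.ne' this
    rcases (show A.card = 1 ∨ B.card = 1 ∨ (2 ≤ A.card ∧ 2 ≤ B.card) by omega) with h | h | ⟨h, h'⟩
    · rw [← hAB]; exact starOn_of hd hs' h hEB
    · rw [← hAB, Finset.union_comm]
      exact starOn_of hd.symm (fun b hb a ha => (hs' a ha b hb).symm) h hEA
    · have := gg_lt h h'
      rw [hc] at this
      linarith

theorem mstarSets_eq {V : Type*} [Fintype V] (G : SimpleGraph V) :
    mstarSets G = EE G Finset.univ := by
  ext S; simp [mstarSets, mem_EE]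

theorem mstar_of_star {V : Type*} [Fintype V] {G : SimpleGraph V} {c : V}
    (h : StarOn G Finset.univ c) :
    mstarMean G = if Fintype.card V = 1 then 0 else hh (Fintype.card V - 1) := by
  unfold mstarMean
  rw [mstarSets_eq]
  split_ifs with h1
  · rw [EE_empty_of_card (by simp [h1])]; simp
  · have : 0 < Fintype.card V := Fintype.card_pos_iff.mpr ⟨c⟩
    obtain ⟨h2, h3⟩ := star_mean h (by rw [Finset.card_univ]; omega)
    rw [h2, Finset.card_univ]
    have : ((EE G Finset.univ).card : ℝ) ≠ 0 := by exact_mod_cast h3.ne'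
    field_simp

theorem bip_star (m : ℕ) :
    StarOn (completeBipartiteGraph (Fin 1) (Fin m)) Finset.univ (Sum.inl 0) := by
  refine ⟨by simp, ?_⟩
  rintro (x | x) - (y | y) - <;> simp [Subsingleton.elim _ (0 : Fin 1)]

theorem iso_of_star {V : Type*} [Fintype V] {G : SimpleGraph V} {c : V}
    (h : StarOn G Finset.univ c) {m : ℕ} (hm : Fintype.card V = m + 1) :
    Nonempty (G ≃g completeBipartiteGraph (Fin 1) (Fin m)) := by
  have e0 : Fintype.card V = Fintype.card (Fin 1 ⊕ Fin m) := by simp [hm, add_comm]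
  let e1 := Fintype.equivOfCardEq e0
  let e : V ≃ Fin 1 ⊕ Fin m := e1.trans (Equiv.swap (e1 c) (Sum.inl 0))
  have hec : e c = Sum.inl 0 := by simp [e]
  refine ⟨⟨e, ?_⟩⟩
  intro x y
  rw [h.2 x (by simp) y (by simp), (bip_star m).2 _ (by simp) _ (by simp), ← hec]
  simp

theorem star_of_iso {V : Type*} [Fintype V] {G : SimpleGraph V} {m : ℕ}
    (f : G ≃g completeBipartiteGraph (Fin 1) (Fin m)) :
    StarOn G Finset.univ (f.symm (Sum.inl 0)) := by
  refine ⟨by simp, fun x _ y _ => ?_⟩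
  rw [← f.map_adj_iff, (bip_star m).2 _ (by simp) _ (by simp)]
  have : ∀ z, f z = Sum.inl 0 ↔ z = f.symm (Sum.inl 0) := by
    intro z
    constructor
    · intro h; rw [← h]; simp
    · rintro rfl; simp
  simp only [ne_eq, this]

end StmtHelpers

theorem stmt_8 {V : Type*} [Fintype V] (G : SimpleGraph V) (n : ℕ) (hn : 1 ≤ n)
    (hcard : Fintype.card V = n) (hcog : IsCograph G) :
    mstarMean G ≤ mstarMean (completeBipartiteGraph (Fin 1) (Fin (n - 1))) ∧
      (mstarMean G = mstarMean (completeBipartiteGraph (Fin 1) (Fin (n - 1))) ↔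
        Nonempty (G ≃g completeBipartiteGraph (Fin 1) (Fin (n - 1)))) := by
  obtain ⟨m, rfl⟩ : ∃ m, n = m + 1 := ⟨n - 1, by omega⟩
  rw [show m + 1 - 1 = m from rfl]
  have hstar : mstarMean (completeBipartiteGraph (Fin 1) (Fin m)) =
      if Fintype.card V = 1 then 0 else hh (Fintype.card V - 1) := by
    rw [mstar_of_star (bip_star m)]
    simp [hcard, add_comm]
  have hback : Nonempty (G ≃g completeBipartiteGraph (Fin 1) (Fin m)) →
      mstarMean G = mstarMean (completeBipartiteGraph (Fin 1) (Fin m)) := by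
    rintro ⟨f⟩
    rw [mstar_of_star (star_of_iso f), hstar]
  by_cases h1 : Fintype.card V = 1
  · have : Nonempty (G ≃g completeBipartiteGraph (Fin 1) (Fin m)) := by
      obtain ⟨c, hc⟩ := Fintype.card_eq_one_iff.mp h1
      apply iso_of_star (c := c) _ hcard
      refine ⟨by simp, fun x _ y _ => ?_⟩
      rw [hc x, hc y]; simp
    exact ⟨(hback this).le, fun _ => this, hback⟩
  · rw [if_neg h1] at hstar
    obtain ⟨k1, k2⟩ := key (p4free_of_cograph hcog) _ (Finset.univ : Finset V) rfl
    rw [Finset.card_univ] at k1 k2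
    rcases Nat.eq_zero_or_pos (EE G Finset.univ).card with h0 | hpos
    · have hz : mstarMean G = 0 := by
        unfold mstarMean
        rw [mstarSets_eq, h0]; simp
      have hp := hh_pos (Fintype.card V - 1)
      refine ⟨by rw [hz, hstar]; exact hp.le, fun he => ?_, hback⟩
      rw [hz, hstar] at he
      linarith
    · have hp : (0 : ℝ) < (EE G Finset.univ).card := by exact_mod_cast hpos
      have hm : mstarMean G = (∑ S ∈ EE G Finset.univ, (S.card : ℝ)) / (EE G Finset.univ).card := by
        unfold mstarMean
        rw [mstarSets_eq]
      refine ⟨by rw [hm, hstar, div_le_iff₀ hp]; exact k1, fun he => ?_, hback⟩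
      rw [hm, hstar, div_eq_iff hp.ne'] at he
      obtain ⟨c, hc⟩ := k2 he hpos
      exact iso_of_star hc hcard
end

section
/- Let G be a connected cograph of order n ≥ 6 whose vertex set can be partitioned into two nonempty sets V_1 and V_2 of sizes s and n−s respectively such that every vertex of V_1 is adjacent to every vertex of V_2 (i.e., G is the join of the two cographs induced on V_1 and V_2). Then M_G ≤ M_{K_{s,n−s}}, with equality if and only if G is isomorphic to K_{s,n−s}. -/
open SimpleGraph Finset

namespace CogAux

section
variable {V : Type*}

def NoP4 (G : SimpleGraph V) : Prop :=
  ∀ a b c d, G.Adj a b → G.Adj b c → G.Adj c d → ¬ G.Adj a c → ¬ G.Adj a d → ¬ G.Adj b d → False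

lemma noP4_of_cograph {G : SimpleGraph V} (h : IsCograph G) : NoP4 G := by
  intro a b c d hab hbc hcd hac had hbd
  have h1 : a ≠ c := by rintro rfl; exact had hcd
  have h2 : a ≠ d := by rintro rfl; exact hac hcd.symm
  have h3 : b ≠ d := by rintro rfl; exact had hab
  have h4 := hab.ne
  have h5 := hbc.ne
  have h6 := hcd.ne
  refine h.false ⟨⟨![a, b, c, d], ?_⟩, ?_⟩
  · intro i j hij
    fin_cases i <;> fin_cases j <;> simp_all
  · intro i j
    have hba := hab.symm
    have hcb := hbc.symm
    have hdc := hcd.symm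
    have hca : ¬ G.Adj c a := fun h => hac h.symm
    have hda : ¬ G.Adj d a := fun h => had h.symm
    have hdb : ¬ G.Adj d b := fun h => hbd h.symm
    change G.Adj (![a, b, c, d] i) (![a, b, c, d] j) ↔ _
    fin_cases i <;> fin_cases j <;> simp [pathGraph_adj, *]

lemma NoP4.compl {G : SimpleGraph V} (h : NoP4 G) : NoP4 Gᶜ := by
  intro a b c d hab hbc hcd hac had hbd
  have h1 : a ≠ c := by rintro rfl; exact had hcd
  have h2 : a ≠ d := by rintro rfl; exact hac hcd.symm
  have h3 : b ≠ d := by rintro rfl; exact had hab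
  simp only [compl_adj, not_and, not_not] at *
  exact h b d a c (hbd h3) (had h2).symm (hac h1) (fun h => hab.2 h.symm) hbc.2
    (fun h => hcd.2 h.symm)

variable [DecidableEq V]

lemma step_anti (G : SimpleGraph V) (h : NoP4 G) (v : V) (A B : Finset V) (hv : v ∉ A ∪ B)
    (hA : A.Nonempty) (hB : B.Nonempty) (hd : Disjoint A B)
    (hn : ∀ a ∈ A, ∀ b ∈ B, ¬ G.Adj a b) :
    ∃ A' B' : Finset V, A'.Nonempty ∧ B'.Nonempty ∧ Disjoint A' B' ∧ A' ∪ B' = insert v (A ∪ B) ∧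
      ((∀ a ∈ A', ∀ b ∈ B', G.Adj a b) ∨ (∀ a ∈ A', ∀ b ∈ B', ¬ G.Adj a b)) := by
  classical
  -- auxiliary: handle a nonneighbour in `A`
  have key : ∀ A B : Finset V, v ∉ A ∪ B → A.Nonempty → B.Nonempty → Disjoint A B →
      (∀ a ∈ A, ∀ b ∈ B, ¬ G.Adj a b) → (∃ y ∈ A, ¬ G.Adj v y) →
      ∃ A' B' : Finset V, A'.Nonempty ∧ B'.Nonempty ∧ Disjoint A' B' ∧
        A' ∪ B' = insert v (A ∪ B) ∧
      ((∀ a ∈ A', ∀ b ∈ B', G.Adj a b) ∨ (∀ a ∈ A', ∀ b ∈ B', ¬ G.Adj a b)) := by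
    intro A B hv hA hB hd hn ⟨y, hy, hvy⟩
    by_cases hz : ∃ z ∈ B, G.Adj v z
    · obtain ⟨z, hzB, hvz⟩ := hz
      refine ⟨A.filter (fun a => ¬ G.Adj v a), insert v (A.filter (fun a => G.Adj v a) ∪ B),
        ⟨y, by simp [hy, hvy]⟩, ⟨v, by simp⟩, ?_, ?_, Or.inr ?_⟩
      · rw [Finset.disjoint_left] at hd ⊢
        intro a ha hb
        simp only [mem_filter, mem_insert, mem_union] at ha hb hv
        rcases hb with rfl | hb | hb
        · exact hv (Or.inl ha.1)
        · exact ha.2 hb.2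
        · exact hd ha.1 hb
      · ext x
        simp only [mem_filter, mem_insert, mem_union]
        tauto
      · intro a ha b hb
        simp only [mem_filter, mem_insert, mem_union] at ha hb
        rcases hb with rfl | hb | hb
        · exact fun h => ha.2 h.symm
        · intro hab
          exact h z v b a hvz.symm hb.2 hab.symm (fun h => hn b hb.1 z hzB h.symm)
            (fun h => hn a ha.1 z hzB h.symm) ha.2
        · exact hn a ha.1 b hb
    · push Not at hz
      refine ⟨B, insert v A, hB, ⟨v, by simp⟩, ?_, ?_, Or.inr ?_⟩
      · rw [Finset.disjoint_insert_right]
        exact ⟨fun h => hv (by simp [h]), hd.symm⟩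
      · ext x
        simp only [mem_insert, mem_union]
        tauto
      · intro b hb a ha
        simp only [mem_insert] at ha
        rcases ha with rfl | ha
        · exact fun h => hz b hb h.symm
        · exact fun h => hn a ha b hb h.symm
  by_cases hy : ∃ y ∈ A, ¬ G.Adj v y
  · exact key A B hv hA hB hd hn hy
  by_cases hy' : ∃ y ∈ B, ¬ G.Adj v y
  · rw [Finset.union_comm] at hv ⊢
    exact key B A hv hB hA hd.symm (fun b hb a ha h => hn a ha b hb h.symm) hy'
  push Not at hy hy'
  refine ⟨{v}, A ∪ B, by simp, hA.mono subset_union_left, by simpa using hv, by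
    ext; simp, Or.inl ?_⟩
  intro a ha b hb
  simp only [mem_singleton, mem_union] at ha hb
  subst ha
  exact hb.elim (hy b) (hy' b)

lemma seinsche (G : SimpleGraph V) (h : NoP4 G) (U : Finset V) : 2 ≤ U.card →
    ∃ A B : Finset V, A.Nonempty ∧ B.Nonempty ∧ Disjoint A B ∧ A ∪ B = U ∧
      ((∀ a ∈ A, ∀ b ∈ B, G.Adj a b) ∨ (∀ a ∈ A, ∀ b ∈ B, ¬ G.Adj a b)) := by
  classical
  induction U using Finset.induction_on with
  | empty => simp
  | insert v W hv ih =>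
    intro hc
    rw [card_insert_of_notMem hv] at hc
    by_cases h2 : 2 ≤ W.card
    · obtain ⟨A, B, hA, hB, hd, rfl, hh | hh⟩ := ih h2
      · obtain ⟨A', B', h1, h2, h3, h4, h5⟩ := step_anti Gᶜ h.compl v A B hv hA hB hd
          (fun a ha b hb h => (compl_adj _ _ _ |>.1 h).2 (hh a ha b hb))
        refine ⟨A', B', h1, h2, h3, h4, ?_⟩
        have hne : ∀ a ∈ A', ∀ b ∈ B', a ≠ b := fun a ha b hb e =>
          (Finset.disjoint_left.1 h3 ha) (e ▸ hb)
        rcases h5 with h5 | h5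
        · exact Or.inr fun a ha b hb => (compl_adj _ _ _ |>.1 (h5 a ha b hb)).2
        · refine Or.inl fun a ha b hb => ?_
          have := h5 a ha b hb
          simp only [compl_adj, not_and, not_not] at this
          exact this (hne a ha b hb)
      · exact step_anti G h v A B hv hA hB hd hh
    · have : W.card = 1 := by omega
      obtain ⟨w, rfl⟩ := card_eq_one.1 this
      refine ⟨{v}, {w}, by simp, by simp, by simpa using hv, by ext; simp, ?_⟩
      simp only [mem_singleton, forall_eq]
      exact em _

lemma conn_join (G : SimpleGraph V) (S A : Set V) {x y : V} (hx : x ∈ S) (hxA : x ∈ A)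
    (hy : y ∈ S) (hyA : y ∉ A) (hj : ∀ u ∈ S, u ∈ A → ∀ w ∈ S, w ∉ A → G.Adj u w) :
    (G.induce S).Connected := by
  rw [connected_iff_exists_forall_reachable]
  refine ⟨⟨x, hx⟩, ?_⟩
  rintro ⟨u, hu⟩
  have h1 : (G.induce S).Adj ⟨x, hx⟩ ⟨y, hy⟩ := hj x hx hxA y hy hyA
  by_cases huA : u ∈ A
  · have h2 : (G.induce S).Adj ⟨y, hy⟩ ⟨u, hu⟩ := (hj u hu huA y hy hyA).symm
    exact h1.reachable.trans h2.reachable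
  · have h2 : (G.induce S).Adj ⟨x, hx⟩ ⟨u, hu⟩ := hj x hx hxA u hu huA
    exact h2.reachable

lemma conn_anti (G : SimpleGraph V) (S A : Set V) (hc : (G.induce S).Connected)
    (hn : ∀ u ∈ S, u ∈ A → ∀ w ∈ S, w ∉ A → ¬ G.Adj u w) {x : V} (hx : x ∈ S) (hxA : x ∈ A) :
    S ⊆ A := by
  intro u hu
  obtain ⟨p⟩ := hc.preconnected ⟨x, hx⟩ ⟨u, hu⟩
  have : ∀ (a b : S), (G.induce S).Walk a b → a.1 ∈ A → b.1 ∈ A := by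
    intro a b p
    induction p with
    | nil => exact id
    | cons hadj p ih =>
      intro ha
      apply ih
      by_contra hb
      exact hn _ (Subtype.property _) ha _ (Subtype.property _) hb hadj
  exact this _ _ p hxA

open Classical in
noncomputable def E (G : SimpleGraph V) (U : Finset V) : Finset (Finset V) :=
  U.powerset.filter (fun S => 2 ≤ S.card ∧ (G.induce (S : Set V)).Connected)

def Mx (A B : Finset V) : Finset (Finset V) :=
  (A ∪ B).powerset.filter (fun S => (S ∩ A).Nonempty ∧ (S ∩ B).Nonempty)

lemma mem_E {G : SimpleGraph V} {U S : Finset V} :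
    S ∈ E G U ↔ S ⊆ U ∧ 2 ≤ S.card ∧ (G.induce (S : Set V)).Connected := by
  simp [E]

lemma mem_Mx {A B S : Finset V} :
    S ∈ Mx A B ↔ S ⊆ A ∪ B ∧ (∃ x ∈ S, x ∈ A) ∧ (∃ x ∈ S, x ∈ B) := by
  simp only [Mx, Finset.Nonempty, mem_filter, mem_powerset, mem_inter]

lemma disj_E (G : SimpleGraph V) {A B : Finset V} (hd : Disjoint A B) :
    Disjoint (E G A) (E G B) := by
  rw [Finset.disjoint_left] at hd ⊢
  intro S h1 h2
  rw [mem_E] at h1 h2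
  have : S.Nonempty := card_pos.1 (by omega)
  obtain ⟨x, hx⟩ := this
  exact hd (h1.1 hx) (h2.1 hx)

lemma disj_Mx (G : SimpleGraph V) {A B : Finset V} (hd : Disjoint A B) :
    Disjoint (E G A ∪ E G B) (Mx A B) := by
  rw [Finset.disjoint_left] at hd ⊢
  intro S h1 h2
  rw [mem_union, mem_E, mem_E] at h1
  rw [mem_Mx] at h2
  obtain ⟨-, ⟨x, hx, hxA⟩, ⟨y, hy, hyB⟩⟩ := h2
  rcases h1 with h1 | h1
  · exact hd (h1.1 hy) hyB
  · exact hd hxA (h1.1 hx)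

lemma E_join (G : SimpleGraph V) {A B : Finset V} (hd : Disjoint A B)
    (hj : ∀ a ∈ A, ∀ b ∈ B, G.Adj a b) : E G (A ∪ B) = (E G A ∪ E G B) ∪ Mx A B := by
  rw [Finset.disjoint_left] at hd
  ext S
  simp only [mem_union, mem_E, mem_Mx]
  constructor
  · rintro ⟨h1, h2, h3⟩
    by_cases hA : S ⊆ A
    · exact Or.inl (Or.inl ⟨hA, h2, h3⟩)
    by_cases hB : S ⊆ B
    · exact Or.inl (Or.inr ⟨hB, h2, h3⟩)
    right
    rw [Finset.not_subset] at hA hB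
    obtain ⟨x, hx, hxA⟩ := hA
    obtain ⟨y, hy, hyB⟩ := hB
    refine ⟨h1, ⟨y, hy, ?_⟩, ⟨x, hx, ?_⟩⟩
    · exact (mem_union.1 (h1 hy)).resolve_right hyB
    · exact (mem_union.1 (h1 hx)).resolve_left hxA
  · rintro ((⟨h1, h2⟩ | ⟨h1, h2⟩) | ⟨h1, ⟨x, hx, hxA⟩, ⟨y, hy, hyB⟩⟩)
    · exact ⟨h1.trans subset_union_left, h2⟩
    · exact ⟨h1.trans subset_union_right, h2⟩
    · have hyA : y ∉ A := fun h => hd h hyB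
      refine ⟨h1, ?_, ?_⟩
      · exact one_lt_card.2 ⟨x, hx, y, hy, fun e => hyA (e ▸ hxA)⟩
      · refine conn_join G S A (by exact_mod_cast hx) (by exact_mod_cast hxA)
          (by exact_mod_cast hy) (by exact_mod_cast hyA) ?_
        intro u hu huA w hw hwA
        simp only [mem_coe] at *
        exact hj u huA w ((mem_union.1 (h1 hw)).resolve_left hwA)

lemma E_anti (G : SimpleGraph V) {A B : Finset V}
    (hj : ∀ a ∈ A, ∀ b ∈ B, ¬ G.Adj a b) : E G (A ∪ B) = E G A ∪ E G B := by
  ext S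
  simp only [mem_union, mem_E]
  constructor
  · rintro ⟨h1, h2, h3⟩
    by_cases hB : S ⊆ B
    · exact Or.inr ⟨hB, h2, h3⟩
    left
    rw [Finset.not_subset] at hB
    obtain ⟨y, hy, hyB⟩ := hB
    refine ⟨?_, h2, h3⟩
    have := conn_anti G S A h3 (x := y) ?_ (by exact_mod_cast hy)
      (by exact_mod_cast (mem_union.1 (h1 hy)).resolve_right hyB)
    · exact_mod_cast this
    · intro u hu huA w hw hwA
      simp only [mem_coe] at *
      exact hj u huA w ((mem_union.1 (h1 hw)).resolve_left hwA)
  · rintro (⟨h1, h2⟩ | ⟨h1, h2⟩)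
    · exact ⟨h1.trans subset_union_left, h2⟩
    · exact ⟨h1.trans subset_union_right, h2⟩

lemma E_empty_of_card (G : SimpleGraph V) {U : Finset V} (h : U.card < 2) : E G U = ∅ := by
  ext S
  simp only [mem_E, Finset.notMem_empty, iff_false]
  rintro ⟨h1, h2, -⟩
  have := card_le_card h1
  omega

lemma E_edgeless (G : SimpleGraph V) (U : Finset V) (h : ∀ a ∈ U, ∀ b ∈ U, ¬ G.Adj a b) :
    E G U = ∅ := by
  induction U using Finset.induction_on with
  | empty => exact E_empty_of_card G (by simp)
  | insert v W hv ih =>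
    rw [Finset.insert_eq, E_anti, ih, E_empty_of_card] <;> simp_all

lemma edgeless_of_E (G : SimpleGraph V) (U : Finset V) (h : E G U = ∅) :
    ∀ a ∈ U, ∀ b ∈ U, ¬ G.Adj a b := by
  intro a ha b hb hab
  have : ({a, b} : Finset V) ∈ E G U := by
    rw [mem_E]
    refine ⟨by simp [Finset.insert_subset_iff, ha, hb], by rw [card_pair hab.ne], ?_⟩
    refine conn_join G _ {a} (x := a) (y := b) (by simp) (by simp) (by simp)
      (by simpa using hab.ne') ?_
    intro u _ hu w hw hw'
    simp at *
    subst hu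
    rcases hw with rfl | rfl
    · exact absurd rfl hw'
    · exact hab
  rw [h] at this
  simp at this

lemma sum_pow (U : Finset V) (k : ℝ) :
    ∑ S ∈ U.powerset, (2 * (S.card : ℝ) - k) = 2 ^ U.card * (U.card - k) := by
  classical
  induction U using Finset.induction_on generalizing k with
  | empty => simp
  | insert v W hv ih =>
    rw [Finset.sum_powerset_insert hv, ih]
    have : ∑ t ∈ W.powerset, (2 * ((insert v t).card : ℝ) - k) =
        ∑ t ∈ W.powerset, (2 * (t.card : ℝ) - (k - 2)) := by
      refine sum_congr rfl fun t ht => ?_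
      rw [card_insert_of_notMem fun h => hv (mem_powerset.1 ht h)]
      push_cast; ring
    rw [this, ih, card_insert_of_notMem hv]
    push_cast; ring

lemma pow_split {A B : Finset V} (hd : Disjoint A B) (f : Finset V → ℝ) :
    ∑ S ∈ (A ∪ B).powerset, f S =
      ∑ S ∈ Mx A B, f S + ∑ S ∈ A.powerset, f S + ∑ S ∈ B.powerset, f S - f ∅ := by
  have hi : A.powerset ∩ B.powerset = {∅} := by
    ext S
    simp only [mem_inter, mem_powerset, mem_singleton]
    constructor
    · rintro ⟨h1, h2⟩
      exact Finset.subset_empty.1 (by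
        rw [← Finset.disjoint_iff_inter_eq_empty.1 hd]; exact subset_inter h1 h2)
    · rintro rfl; simp
  have h1 := Finset.sum_union_inter (s₁ := A.powerset) (s₂ := B.powerset) (f := f)
  rw [hi, sum_singleton] at h1
  have h2 : Disjoint (Mx A B) (A.powerset ∪ B.powerset) := by
    rw [Finset.disjoint_left] at hd ⊢
    intro S h1 h2
    rw [mem_Mx] at h1
    obtain ⟨-, ⟨x, hx, hxA⟩, ⟨y, hy, hyB⟩⟩ := h1
    simp only [mem_union, mem_powerset] at h2
    rcases h2 with h2 | h2
    · exact hd (h2 hy) hyB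
    · exact hd hxA (h2 hx)
  have h3 : (A ∪ B).powerset = Mx A B ∪ (A.powerset ∪ B.powerset) := by
    ext S
    simp only [mem_union, mem_Mx, mem_powerset]
    constructor
    · intro h
      by_cases hA : S ⊆ A
      · exact Or.inr (Or.inl hA)
      by_cases hB : S ⊆ B
      · exact Or.inr (Or.inr hB)
      left
      rw [Finset.not_subset] at hA hB
      obtain ⟨x, hx, hxA⟩ := hA
      obtain ⟨y, hy, hyB⟩ := hB
      exact ⟨h, ⟨y, hy, (mem_union.1 (h hy)).resolve_right hyB⟩,
        ⟨x, hx, (mem_union.1 (h hx)).resolve_left hxA⟩⟩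
    · rintro (h | h | h)
      · exact h.1
      · exact h.trans subset_union_left
      · exact h.trans subset_union_right
  rw [h3, sum_union h2]
  linarith

lemma card_Mx {A B : Finset V} (hd : Disjoint A B) :
    ((Mx A B).card : ℝ) = (2 ^ A.card - 1) * (2 ^ B.card - 1) := by
  have := pow_split hd (fun _ => 1)
  simp only [sum_const, card_powerset, nsmul_eq_mul, mul_one, card_union_of_disjoint hd] at this
  push_cast at this
  rw [pow_add] at this
  linarith

lemma sum_Mx {A B : Finset V} (hd : Disjoint A B) :
    ∑ S ∈ Mx A B, (2 * (S.card : ℝ) - (A.card + B.card)) =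
      B.card * (2 ^ A.card - 1) + A.card * (2 ^ B.card - 1) := by
  have := pow_split hd (fun S => 2 * (S.card : ℝ) - (A.card + B.card))
  simp only [sum_pow, card_union_of_disjoint hd] at this
  push_cast at this
  simp only [Finset.card_empty] at this
  push_cast at this
  linarith

lemma bound_step (G : SimpleGraph V) (h : NoP4 G) (U : Finset V) (hU : 2 ≤ U.card) (c : ℝ)
    (hc : 1 ≤ c)
    (ih : ∀ A : Finset V, A.card < U.card →
      ∑ S ∈ E G A, (2 * (S.card : ℝ) - A.card - 2) ≤ 0)
    (hm : ∀ a b : ℕ, 1 ≤ a → 1 ≤ b → a + b = U.card →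
      (b : ℝ) * (2 ^ a - 1) + a * (2 ^ b - 1) ≤ c * ((2 ^ a - 1) * (2 ^ b - 1))) :
    ∑ S ∈ E G U, (2 * (S.card : ℝ) - U.card - c) ≤ 0 := by
  obtain ⟨A, B, hA, hB, hd, rfl, hh⟩ := seinsche G h U hU
  have hA1 : 1 ≤ A.card := card_pos.2 hA
  have hB1 : 1 ≤ B.card := card_pos.2 hB
  have hcard := card_union_of_disjoint hd
  have hA1' : (1 : ℝ) ≤ A.card := by exact_mod_cast hA1
  have hB1' : (1 : ℝ) ≤ B.card := by exact_mod_cast hB1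
  have hcard' : ((A ∪ B).card : ℝ) = A.card + B.card := by exact_mod_cast hcard
  have h1 : ∑ S ∈ E G A, (2 * (S.card : ℝ) - (A ∪ B).card - c) ≤ 0 :=
    (sum_le_sum fun S _ => by rw [hcard']; linarith).trans (ih A (by omega))
  have h2 : ∑ S ∈ E G B, (2 * (S.card : ℝ) - (A ∪ B).card - c) ≤ 0 :=
    (sum_le_sum fun S _ => by rw [hcard']; linarith).trans (ih B (by omega))
  rcases hh with hh | hh
  · have h3 : ∑ S ∈ Mx A B, (2 * (S.card : ℝ) - (A ∪ B).card - c) ≤ 0 := by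
      rw [sum_sub_distrib, hcard', sum_Mx hd, sum_const, nsmul_eq_mul, card_Mx hd]
      linarith [hm _ _ hA1 hB1 hcard.symm]
    rw [E_join G hd hh, sum_union (disj_Mx G hd), sum_union (disj_E G hd)]
    linarith
  · rw [E_anti G hh, sum_union (disj_E G hd)]
    linarith

lemma two_pow_sub (a : ℕ) : (a : ℝ) ≤ 2 ^ a - 1 := by
  have : a + 1 ≤ 2 ^ a := Nat.lt_two_pow_self
  have : ((a + 1 : ℕ) : ℝ) ≤ ((2 ^ a : ℕ) : ℝ) := by exact_mod_cast this
  push_cast at this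
  linarith

lemma bound_two (G : SimpleGraph V) (h : NoP4 G) (k : ℕ) : ∀ U : Finset V, U.card = k →
    ∑ S ∈ E G U, (2 * (S.card : ℝ) - U.card - 2) ≤ 0 := by
  induction k using Nat.strong_induction_on with
  | _ k ih =>
    rintro U rfl
    by_cases hU : U.card < 2
    · rw [E_empty_of_card G hU]; simp
    refine bound_step G h U (by omega) 2 (by norm_num) (fun A hA => ih _ hA A rfl) ?_
    intro a b ha hb _
    have h1 := two_pow_sub a
    have h2 := two_pow_sub b
    have ha' : (1 : ℝ) ≤ a := by exact_mod_cast ha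
    have hb' : (1 : ℝ) ≤ b := by exact_mod_cast hb
    nlinarith [mul_le_mul_of_nonneg_right h1 (show (0:ℝ) ≤ 2 ^ b - 1 by linarith),
      mul_le_mul_of_nonneg_right h2 (show (0:ℝ) ≤ 2 ^ a - 1 by linarith)]

lemma aux4 (k : ℕ) (hk : 4 ≤ k) : 10 * (k : ℝ) ≤ 3 * (2 ^ k - 1) := by
  induction k, hk using Nat.le_induction with
  | base => norm_num
  | succ k hk ih =>
    have : (4 : ℝ) ≤ k := by exact_mod_cast hk
    rw [pow_succ]; push_cast; linarith

lemma aux3 (k : ℕ) (hk : 3 ≤ k) : 7 * (k : ℝ) ≤ 3 * (2 ^ k - 1) := by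
  induction k, hk using Nat.le_induction with
  | base => norm_num
  | succ k hk ih =>
    have : (3 : ℝ) ≤ k := by exact_mod_cast hk
    rw [pow_succ]; push_cast; linarith

lemma aux2 (k : ℕ) (hk : 2 ≤ k) : 3 * (k : ℝ) ≤ 2 * (2 ^ k - 1) := by
  induction k, hk using Nat.le_induction with
  | base => norm_num
  | succ k hk ih =>
    have : (2 : ℝ) ≤ k := by exact_mod_cast hk
    rw [pow_succ]; push_cast; linarith

lemma aux5 (k : ℕ) (hk : 5 ≤ k) : 10 * (k : ℝ) ^ 2 < 7 * 2 ^ k + 7 * k := by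
  induction k, hk using Nat.le_induction with
  | base => norm_num
  | succ k hk ih =>
    have : (5 : ℝ) ≤ k := by exact_mod_cast hk
    rw [pow_succ (2 : ℝ)]; push_cast; nlinarith

lemma auxq (k : ℕ) (hk : 1 ≤ k) : (k : ℝ) ^ 2 - k + 2 ≤ 2 ^ k := by
  by_cases h3 : 3 ≤ k
  · clear hk
    induction k, h3 using Nat.le_induction with
    | base => norm_num
    | succ k hk ih =>
      have : (3 : ℝ) ≤ k := by exact_mod_cast hk
      rw [pow_succ (2 : ℝ)]; push_cast; nlinarith
  · interval_cases k <;> norm_num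

lemma mix_ineq (a b : ℕ) (ha : 1 ≤ a) (hb : 1 ≤ b) (hab : 5 ≤ a + b) :
    (b : ℝ) * (2 ^ a - 1) + a * (2 ^ b - 1) ≤ 13 / 10 * ((2 ^ a - 1) * (2 ^ b - 1)) := by
  wlog hle : a ≤ b generalizing a b
  · have := this b a hb ha (by omega) (by omega)
    linarith
  have h1 := two_pow_sub a
  have h2 := two_pow_sub b
  have hx : (0 : ℝ) ≤ 2 ^ a - 1 := le_trans (by positivity) h1
  have hy : (0 : ℝ) ≤ 2 ^ b - 1 := le_trans (by positivity) h2
  by_cases h : a = 1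
  · subst h
    have := aux4 b (by omega)
    norm_num
    linarith
  · have e1 := mul_le_mul_of_nonneg_right (aux2 a (by omega)) hy
    have e2 := mul_le_mul_of_nonneg_right (aux3 b (by omega)) hx
    have e3 := mul_nonneg hx hy
    linarith

lemma bound_E (G : SimpleGraph V) (h : NoP4 G) (U : Finset V) (b : ℕ) (ha : 1 ≤ U.card)
    (hb : 1 ≤ b) (hab : 6 ≤ U.card + b) : ∃ c : ℝ,
    ∑ S ∈ E G U, (2 * (S.card : ℝ) - U.card - c) ≤ 0 ∧
    (c - b) * ((2 ^ U.card - 1) * (2 ^ b - 1) + (U.card + b)) <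
      b * (2 ^ U.card - 1) + U.card * (2 ^ b - 1) + (U.card + b) * (2 - (U.card + b) : ℝ) := by
  by_cases hb1 : b = 1
  · subst hb1
    refine ⟨13 / 10, bound_step G h U (by omega) _ (by norm_num)
      (fun A _ => bound_two G h _ A rfl) (fun a b ha hb hs => mix_ineq a b ha hb (by omega)), ?_⟩
    have := aux5 U.card (by omega)
    push_cast
    nlinarith
  · refine ⟨2, bound_two G h _ U rfl, ?_⟩
    generalize U.card = a at *
    have h1 := two_pow_sub a
    have h2 := two_pow_sub b
    have hx : (0 : ℝ) ≤ 2 ^ a - 1 := le_trans (by positivity) h1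
    have hy : (0 : ℝ) ≤ 2 ^ b - 1 := le_trans (by positivity) h2
    have hb2 : (2 : ℝ) ≤ b := by exact_mod_cast (by omega : 2 ≤ b)
    have ha1 : (1 : ℝ) ≤ a := by exact_mod_cast ha
    have hs : (6 : ℝ) ≤ a + b := by exact_mod_cast hab
    have e1 : (2 - b : ℝ) * ((2 ^ a - 1) * (2 ^ b - 1) + (a + b)) ≤ 0 :=
      mul_nonpos_of_nonpos_of_nonneg (by linarith) (by positivity)
    have e2 := mul_le_mul_of_nonneg_left (auxq a ha) (show (0:ℝ) ≤ b by linarith)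
    have e3 := mul_le_mul_of_nonneg_left (auxq b hb) (show (0:ℝ) ≤ a by linarith)
    have e4 : (a + b - 1 : ℝ) ≤ a * b := by nlinarith
    have e5 := mul_le_mul_of_nonneg_right e4 (show (0:ℝ) ≤ a + b - 2 by linarith)
    nlinarith

end

section
variable {V : Type*} [Fintype V] [DecidableEq V]

lemma mem_conn {G : SimpleGraph V} {S : Finset V} :
    S ∈ connSets G ↔ S.Nonempty ∧ (G.induce (S : Set V)).Connected := by
  simp [connSets]

lemma sum_conn (G : SimpleGraph V) (A : Finset V) (hj : ∀ u ∈ A, ∀ w ∉ A, G.Adj u w)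
    (f : Finset V → ℝ) : ∑ S ∈ connSets G, f S =
      ∑ v : V, f {v} + (∑ S ∈ E G A, f S + ∑ S ∈ E G Aᶜ, f S + ∑ S ∈ Mx A Aᶜ, f S) := by
  have hd : Disjoint A Aᶜ := disjoint_compl_right
  have h1 : connSets G = (univ.map ⟨fun v : V => ({v} : Finset V), singleton_injective⟩) ∪
      E G (A ∪ Aᶜ) := by
    ext S
    simp only [mem_conn, mem_union, mem_map, mem_univ, true_and, Function.Embedding.coeFn_mk,
      mem_E]
    constructor
    · rintro ⟨h1, h2⟩
      by_cases hc : 2 ≤ S.card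
      · exact Or.inr ⟨by simp, hc, h2⟩
      · have := card_pos.2 h1
        obtain ⟨v, hv⟩ := card_eq_one.1 (by omega : S.card = 1)
        exact Or.inl ⟨v, hv.symm⟩
    · rintro (⟨v, rfl⟩ | ⟨-, h2, h3⟩)
      · refine ⟨by simp, ?_⟩
        rw [connected_iff_exists_forall_reachable]
        refine ⟨⟨v, by simp⟩, ?_⟩
        rintro ⟨w, hw⟩
        simp at hw
        subst hw
        rfl
      · exact ⟨card_pos.1 (by omega), h3⟩
  have h2 : Disjoint (univ.map ⟨fun v : V => ({v} : Finset V), singleton_injective⟩)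
      (E G (A ∪ Aᶜ)) := by
    rw [Finset.disjoint_left]
    intro S hS hS'
    rw [mem_E] at hS'
    simp only [mem_map, mem_univ, true_and, Function.Embedding.coeFn_mk] at hS
    obtain ⟨v, rfl⟩ := hS
    simp at hS'
  rw [h1, sum_union h2, sum_map, E_join G hd (fun a ha b hb => hj a ha b (by simpa using hb)),
    sum_union (disj_Mx G hd), sum_union (disj_E G hd)]
  rfl

lemma card_conn (G : SimpleGraph V) (A : Finset V) (hj : ∀ u ∈ A, ∀ w ∉ A, G.Adj u w) :
    ((connSets G).card : ℝ) = ((2 ^ A.card - 1) * (2 ^ Aᶜ.card - 1) + (A.card + Aᶜ.card)) +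
      ((E G A).card + (E G Aᶜ).card) := by
  have h := sum_conn G A hj (fun _ => 1)
  have hc : ((Fintype.card V : ℕ) : ℝ) = A.card + Aᶜ.card := by
    exact_mod_cast (card_add_card_compl A).symm
  simp only [sum_const, nsmul_eq_mul, mul_one, card_univ, hc,
    card_Mx (disjoint_compl_right : Disjoint A Aᶜ)] at h
  linarith

lemma exc_conn (G : SimpleGraph V) (A : Finset V) (hj : ∀ u ∈ A, ∀ w ∉ A, G.Adj u w) :
    ∑ S ∈ connSets G, (2 * (S.card : ℝ) - (A.card + Aᶜ.card)) =
      (Aᶜ.card * (2 ^ A.card - 1) + A.card * (2 ^ Aᶜ.card - 1) +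
        (A.card + Aᶜ.card) * (2 - (A.card + Aᶜ.card) : ℝ)) +
      (∑ S ∈ E G A, (2 * (S.card : ℝ) - (A.card + Aᶜ.card)) +
        ∑ S ∈ E G Aᶜ, (2 * (S.card : ℝ) - (A.card + Aᶜ.card))) := by
  have hc : ((Fintype.card V : ℕ) : ℝ) = A.card + Aᶜ.card := by
    exact_mod_cast (card_add_card_compl A).symm
  rw [sum_conn G A hj, sum_Mx disjoint_compl_right]
  simp only [card_singleton, sum_const, nsmul_eq_mul, card_univ, hc]
  push_cast
  ring

lemma mean_eq (G : SimpleGraph V) (k : ℝ) (h : 0 < ((connSets G).card : ℝ)) :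
    globalMean G = k / 2 +
      (∑ S ∈ connSets G, (2 * (S.card : ℝ) - k)) / (2 * ((connSets G).card : ℝ)) := by
  rw [globalMean, sum_sub_distrib, ← mul_sum, sum_const, nsmul_eq_mul]
  field_simp
  ring

noncomputable def N0 (a b : ℕ) : ℝ := (2 ^ a - 1) * (2 ^ b - 1) + (a + b)
noncomputable def D0 (a b : ℕ) : ℝ :=
  b * (2 ^ a - 1) + a * (2 ^ b - 1) + (a + b) * (2 - (a + b) : ℝ)

lemma N0_pos {a b : ℕ} (ha : 1 ≤ a) : 0 < N0 a b := by
  have h1 := two_pow_sub a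
  have h2 := two_pow_sub b
  have hx : (0 : ℝ) ≤ 2 ^ a - 1 := le_trans (by positivity) h1
  have hy : (0 : ℝ) ≤ 2 ^ b - 1 := le_trans (by positivity) h2
  have : (1 : ℝ) ≤ a := by exact_mod_cast ha
  unfold N0
  positivity

lemma mean_edgeless (G : SimpleGraph V) (A : Finset V) (hj : ∀ u ∈ A, ∀ w ∉ A, G.Adj u w)
    (hA : 1 ≤ A.card) (h1 : E G A = ∅) (h2 : E G Aᶜ = ∅) :
    globalMean G = (A.card + Aᶜ.card : ℝ) / 2 +
      D0 A.card Aᶜ.card / (2 * N0 A.card Aᶜ.card) := by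
  have hc := card_conn G A hj
  have he := exc_conn G A hj
  rw [h1, h2] at hc he
  simp only [sum_empty, Finset.card_empty, add_zero, Nat.cast_zero] at hc he
  have hp := N0_pos (b := Aᶜ.card) hA
  rw [mean_eq G (A.card + Aᶜ.card) (by rw [hc]; exact hp), hc, he]
  rfl

lemma mean_lt (G : SimpleGraph V) (hG : NoP4 G) (A : Finset V)
    (hj : ∀ u ∈ A, ∀ w ∉ A, G.Adj u w)
    (hA : 1 ≤ A.card) (hB : 1 ≤ Aᶜ.card) (h6 : 6 ≤ A.card + Aᶜ.card)
    (hne : ¬ (E G A = ∅ ∧ E G Aᶜ = ∅)) :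
    globalMean G < (A.card + Aᶜ.card : ℝ) / 2 +
      D0 A.card Aᶜ.card / (2 * N0 A.card Aᶜ.card) := by
  have hc := card_conn G A hj
  have he := exc_conn G A hj
  have hp := N0_pos (b := Aᶜ.card) hA
  obtain ⟨c, c1, c2⟩ := bound_E G hG A Aᶜ.card hA hB h6
  obtain ⟨d, d1, d2⟩ := bound_E G hG Aᶜ A.card hB hA (by omega)
  change _ = N0 A.card Aᶜ.card + _ at hc
  change _ = D0 A.card Aᶜ.card + _ at he
  change _ * N0 A.card Aᶜ.card < D0 A.card Aᶜ.card at c2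
  have d2' : (d - A.card) * N0 A.card Aᶜ.card < D0 A.card Aᶜ.card := by
    unfold N0 D0; linarith
  have hdA : ∑ S ∈ E G A, (2 * (S.card : ℝ) - (A.card + Aᶜ.card)) ≤
      (c - Aᶜ.card) * (E G A).card := by
    simp only [sum_sub_distrib, sum_const, nsmul_eq_mul] at c1 ⊢
    linarith
  have hdB : ∑ S ∈ E G Aᶜ, (2 * (S.card : ℝ) - (A.card + Aᶜ.card)) ≤
      (d - A.card) * (E G Aᶜ).card := by
    simp only [sum_sub_distrib, sum_const, nsmul_eq_mul] at d1 ⊢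
    linarith
  have eA : (0 : ℝ) ≤ (E G A).card := by positivity
  have eB : (0 : ℝ) ≤ (E G Aᶜ).card := by positivity
  rw [mean_eq G (A.card + Aᶜ.card) (by rw [hc]; linarith), hc, he]
  generalize ∑ S ∈ E G A, (2 * (S.card : ℝ) - (A.card + Aᶜ.card)) = dA at *
  generalize ∑ S ∈ E G Aᶜ, (2 * (S.card : ℝ) - (A.card + Aᶜ.card)) = dB at *
  have hpos : 0 < (E G A).card ∨ 0 < (E G Aᶜ).card := by
    by_contra hh
    push Not at hh
    exact hne ⟨card_eq_zero.1 (by omega), card_eq_zero.1 (by omega)⟩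
  have hpos' : (0 : ℝ) < (E G A).card ∨ (0 : ℝ) < (E G Aᶜ).card := by exact_mod_cast hpos
  generalize ((E G A).card : ℝ) = x at *
  generalize ((E G Aᶜ).card : ℝ) = y at *
  generalize N0 A.card Aᶜ.card = N at *
  generalize D0 A.card Aᶜ.card = D at *
  have f1 := mul_le_mul_of_nonneg_right hdA hp.le
  have f2 := mul_le_mul_of_nonneg_right hdB hp.le
  have g1 := mul_le_mul_of_nonneg_right c2.le eA
  have g2 := mul_le_mul_of_nonneg_right d2'.le eB
  have key : (dA + dB) * N < D * (x + y) := by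
    rcases hpos' with hx | hy
    · have := mul_lt_mul_of_pos_right c2 hx
      nlinarith
    · have := mul_lt_mul_of_pos_right d2' hy
      nlinarith
  rw [add_lt_add_iff_left, div_lt_div_iff₀ (by linarith) (by linarith)]
  nlinarith

end

lemma conn_iso {V W : Type*} {G : SimpleGraph V} {H : SimpleGraph W} (e : G ≃g H) (S : Set V) :
    (G.induce S).Connected ↔ (H.induce (e '' S)).Connected := by
  let f : G.induce S ≃g H.induce (e '' S) :=
    ⟨e.toEquiv.image S, by
      rintro ⟨a, ha⟩ ⟨b, hb⟩
      exact e.map_rel_iff⟩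
  exact f.connected_iff

lemma mean_iso {V W : Type*} [Fintype V] [Fintype W] {G : SimpleGraph V} {H : SimpleGraph W}
    (e : G ≃g H) : globalMean G = globalMean H := by
  classical
  have h : connSets H = (connSets G).map (Equiv.finsetCongr e.toEquiv).toEmbedding := by
    ext S
    rw [Finset.mem_map_equiv, mem_conn, mem_conn, conn_iso e]
    have : (e '' (((Equiv.finsetCongr e.toEquiv).symm S : Finset V) : Set V)) = S := by
      ext x
      simp only [Equiv.finsetCongr, Set.mem_image]
      simp
      constructor
      · rintro ⟨y, hy, rfl⟩
        exact hy
      · intro hx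
        exact ⟨e.symm x, by simpa using hx, by simp⟩
    rw [this]
    simp [Equiv.finsetCongr]
  rw [globalMean, globalMean, h, sum_map, card_map]
  simp [Equiv.finsetCongr]

end CogAux

open CogAux in
theorem stmt_10 {V : Type*} [Fintype V] [DecidableEq V] (G : SimpleGraph V) (n s : ℕ)
    (hn : 6 ≤ n) (hcard : Fintype.card V = n) (hcog : IsCograph G) (hconn : G.Connected)
    (A : Finset V) (hAcard : A.card = s) (hA1 : A.Nonempty) (hA2 : Aᶜ.Nonempty)
    (hjoin : ∀ u ∈ A, ∀ w ∉ A, G.Adj u w) :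
    globalMean G ≤ globalMean (completeBipartiteGraph (Fin s) (Fin (n - s))) ∧
      (globalMean G = globalMean (completeBipartiteGraph (Fin s) (Fin (n - s))) ↔
        Nonempty (G ≃g completeBipartiteGraph (Fin s) (Fin (n - s)))) := by
  have hB : Aᶜ.card = n - s := by rw [card_compl, hcard, hAcard]
  have hA1' := card_pos.2 hA1
  have hA2' := card_pos.2 hA2
  have hK : globalMean (completeBipartiteGraph (Fin s) (Fin (n - s))) =
      (A.card + Aᶜ.card : ℝ) / 2 + D0 A.card Aᶜ.card / (2 * N0 A.card Aᶜ.card) := by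
    let L : Finset (Fin s ⊕ Fin (n - s)) := univ.map Function.Embedding.inl
    have hL : L.card = s := by simp [L]
    have hL' : Lᶜ.card = n - s := by rw [card_compl, hL]; simp
    rw [hAcard, hB]
    have := mean_edgeless (completeBipartiteGraph (Fin s) (Fin (n - s))) L ?_ (by omega)
      (E_edgeless _ _ ?_) (E_edgeless _ _ ?_)
    · rw [this, hL, hL']
    · rintro (u | u) hu (w | w) hw <;> simp_all [L]
    · rintro (u | u) hu (w | w) hw <;> simp_all [L]
    · rintro (u | u) hu (w | w) hw <;> simp_all [L]
  by_cases hne : E G A = ∅ ∧ E G Aᶜ = ∅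
  · have heq := mean_edgeless G A hjoin hA1' hne.1 hne.2
    rw [← hK] at heq
    refine ⟨heq.le, fun _ => ?_, fun _ => heq⟩
    have n1 := edgeless_of_E G A hne.1
    have n2 := edgeless_of_E G Aᶜ hne.2
    let e1 : {x // x ∈ A} ≃ Fin s := A.equivFinOfCardEq hAcard
    let e2 : {x // x ∉ A} ≃ Fin (n - s) :=
      (Equiv.subtypeEquivRight (by simp)).trans (Aᶜ.equivFinOfCardEq hB)
    let e : V ≃ Fin s ⊕ Fin (n - s) :=
      (Equiv.sumCompl (· ∈ A)).symm.trans (Equiv.sumCongr e1 e2)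
    refine ⟨⟨e, ?_⟩⟩
    intro u w
    by_cases hu : u ∈ A <;> by_cases hw : w ∈ A
    · simp [e, hu, hw, n1 u hu w hw]
    · simp [e, hu, hw, hjoin u hu w hw]
    · simp [e, hu, hw, (hjoin w hw u hu).symm]
    · simp [e, hu, hw, n2 u (by simpa using hu) w (by simpa using hw)]
  · have hlt := mean_lt G (noP4_of_cograph hcog) A hjoin hA1' hA2' (by omega) hne
    rw [← hK] at hlt
    exact ⟨hlt.le, fun h => absurd h hlt.ne, fun ⟨e⟩ => mean_iso e⟩
end

section
/- Let G be a cograph (not necessarily connected) in which every connected component has order at most s. Then M_G ≤ (s+1)/2, with equality if and only if s = 1. -/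
open SimpleGraph Finset

namespace Stmt11

def P4F {V : Type*} (G : SimpleGraph V) : Prop :=
  ∀ a b c d, G.Adj a b → G.Adj b c → G.Adj c d → ¬ G.Adj a c → ¬ G.Adj b d → ¬ G.Adj a d → False

lemma p4f_of_cograph {V : Type*} (G : SimpleGraph V) (h : IsCograph G) : P4F G := by
  intro a b c d hab hbc hcd hac hbd had
  refine h.false ⟨⟨![a, b, c, d], ?_⟩, ?_⟩
  · have h1 : a ≠ c := by rintro rfl; exact had hcd
    have h2 : b ≠ d := by rintro rfl; exact had hab
    have h3 : a ≠ d := by rintro rfl; exact hac hcd.symm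
    have := hab.ne
    have := hbc.ne
    have := hcd.ne
    intro i j hij
    fin_cases i <;> fin_cases j <;> simp_all
  · intro i j
    change G.Adj (![a, b, c, d] i) (![a, b, c, d] j) ↔ _
    have hac' := mt SimpleGraph.Adj.symm hac
    have hbd' := mt SimpleGraph.Adj.symm hbd
    have had' := mt SimpleGraph.Adj.symm had
    have := hab.symm
    have := hbc.symm
    have := hcd.symm
    fin_cases i <;> fin_cases j <;> simp_all [SimpleGraph.pathGraph_adj]

lemma p4f_compl {V : Type*} (G : SimpleGraph V) (h : P4F G) : P4F Gᶜ := by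
  intro a b c d hab hbc hcd hac hbd had
  have h1 : a ≠ c := by rintro rfl; exact had hcd
  have h2 : b ≠ d := by rintro rfl; exact had hab
  have h3 : a ≠ d := by rintro rfl; exact hac hcd.symm
  simp only [SimpleGraph.compl_adj, not_and, not_not] at *
  have e1 := hac h1
  have e2 := hbd h2
  have e3 := had h3
  exact h b d a c e2 e3.symm e1 (fun h => hab.2 h.symm) (fun h => hcd.2 h.symm) hbc.2

def Split {V : Type*} [DecidableEq V] (G : SimpleGraph V) (W : Finset V) : Prop :=
  ∃ A B : Finset V, A.Nonempty ∧ B.Nonempty ∧ Disjoint A B ∧ A ∪ B = W ∧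
    ∀ a ∈ A, ∀ b ∈ B, ¬ G.Adj a b

def Join {V : Type*} [DecidableEq V] (G : SimpleGraph V) (W : Finset V) : Prop :=
  ∃ A B : Finset V, A.Nonempty ∧ B.Nonempty ∧ Disjoint A B ∧ A ∪ B = W ∧
    ∀ a ∈ A, ∀ b ∈ B, G.Adj a b

lemma join_compl {V : Type*} [DecidableEq V] (G : SimpleGraph V) (W : Finset V) :
    Join G W → Split Gᶜ W := by
  rintro ⟨A, B, hA, hB, hd, hu, h⟩
  exact ⟨A, B, hA, hB, hd, hu, fun a ha b hb => by simp [h a ha b hb]⟩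

lemma join_of_compl {V : Type*} [DecidableEq V] (G : SimpleGraph V) (W : Finset V) :
    Join Gᶜ W → Split G W := by
  rintro ⟨A, B, hA, hB, hd, hu, h⟩
  exact ⟨A, B, hA, hB, hd, hu, fun a ha b hb => (h a ha b hb).2⟩

lemma split_of_compl {V : Type*} [DecidableEq V] (G : SimpleGraph V) (W : Finset V) :
    Split Gᶜ W → Join G W := by
  rintro ⟨A, B, hA, hB, hd, hu, h⟩
  refine ⟨A, B, hA, hB, hd, hu, fun a ha b hb => ?_⟩
  have := h a ha b hb
  have hne : a ≠ b := fun e => Finset.disjoint_left.1 hd ha (e ▸ hb)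
  simp only [SimpleGraph.compl_adj, not_and, not_not] at this
  exact this hne

lemma step_aux {V : Type*} [DecidableEq V] (G : SimpleGraph V) (h : P4F G) (A B : Finset V) (v u : V)
    (hv : v ∉ A ∪ B) (hB : B.Nonempty)
    (hd : Disjoint A B) (hAB : ∀ a ∈ A, ∀ b ∈ B, ¬ G.Adj a b) (hu : u ∈ A) (huv : ¬ G.Adj v u) :
    Split G (insert v (A ∪ B)) := by
  classical
  simp only [Finset.mem_union, not_or] at hv
  by_cases hw : ∃ w ∈ B, G.Adj v w
  · obtain ⟨w, hwB, hvw⟩ := hw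
    refine ⟨A.filter (fun x => ¬ G.Adj v x), insert v (A.filter (fun x => G.Adj v x) ∪ B),
      ⟨u, by simp [hu, huv]⟩, ⟨v, by simp⟩, ?_, ?_, ?_⟩
    · rw [Finset.disjoint_left] at hd ⊢
      intro x hx
      simp only [Finset.mem_filter, Finset.mem_insert, Finset.mem_union] at hx ⊢
      rintro (rfl | h1 | h1)
      · exact hv.1 hx.1
      · exact hx.2 h1.2
      · exact hd hx.1 h1
    · ext x
      simp only [Finset.mem_filter, Finset.mem_insert, Finset.mem_union]
      tauto
    · intro x hx y hy hxy
      simp only [Finset.mem_filter, Finset.mem_insert, Finset.mem_union] at hx hy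
      rcases hy with rfl | h1 | h1
      · exact hx.2 hxy.symm
      · exact h x y v w hxy h1.2.symm hvw (fun h => hx.2 h.symm) (hAB y h1.1 w hwB) (hAB x hx.1 w hwB)
      · exact hAB x hx.1 y h1 hxy
  · push Not at hw
    refine ⟨B, insert v A, hB, ⟨v, by simp⟩, ?_, ?_, ?_⟩
    · rw [Finset.disjoint_insert_right]
      exact ⟨hv.2, hd.symm⟩
    · ext x
      simp only [Finset.mem_insert, Finset.mem_union]
      tauto
    · intro x hx y hy hxy
      simp only [Finset.mem_insert] at hy
      rcases hy with rfl | h1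
      · exact hw x hx hxy.symm
      · exact hAB y h1 x hx hxy.symm

lemma step {V : Type*} [DecidableEq V] (G : SimpleGraph V) (h : P4F G) (W : Finset V) (v : V)
    (hv : v ∉ W) (hW : Split G W) : Split G (insert v W) ∨ Join G (insert v W) := by
  obtain ⟨A, B, hA, hB, hd, rfl, hAB⟩ := hW
  by_cases hall : ∀ u ∈ A ∪ B, G.Adj v u
  · right
    refine ⟨{v}, A ∪ B, by simp, hA.mono Finset.subset_union_left, by simpa using hv, rfl, ?_⟩
    simpa using hall
  · push Not at hall
    obtain ⟨u, hu, huv⟩ := hall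
    left
    rcases Finset.mem_union.1 hu with h1 | h1
    · exact step_aux G h A B v u hv hB hd hAB h1 huv
    · rw [Finset.union_comm]
      exact step_aux G h B A v u (by rwa [Finset.union_comm]) hA hd.symm
        (fun a ha b hb e => hAB b hb a ha e.symm) h1 huv

lemma split_or_join {V : Type*} [DecidableEq V] (G : SimpleGraph V) (h : P4F G) (W : Finset V) :
    2 ≤ W.card → Split G W ∨ Join G W := by
  induction W using Finset.induction_on with
  | empty => simp
  | insert v W hv ih =>
    intro hc
    rw [Finset.card_insert_of_notMem hv] at hc
    by_cases h2 : 2 ≤ W.card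
    · rcases ih h2 with h3 | h3
      · exact step G h W v hv h3
      · rcases step Gᶜ (p4f_compl G h) W v hv (join_compl G W h3) with h4 | h4
        · exact Or.inr (split_of_compl _ _ h4)
        · exact Or.inl (join_of_compl _ _ h4)
    · obtain ⟨w, rfl⟩ := Finset.card_eq_one.1 (by omega : W.card = 1)
      have hd : Disjoint ({v} : Finset V) {w} := by simpa using hv
      by_cases ha : G.Adj v w
      · right
        exact ⟨{v}, {w}, by simp, by simp, hd, rfl, by simpa using ha⟩
      · left
        exact ⟨{v}, {w}, by simp, by simp, hd, rfl, by simpa using ha⟩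

lemma mem_connSets {V : Type*} [Fintype V] (G : SimpleGraph V) (S : Finset V) :
    S ∈ connSets G ↔ S.Nonempty ∧ (G.induce (S : Set V)).Connected := by
  simp [connSets]

lemma conn_split {V : Type*} [DecidableEq V] (G : SimpleGraph V) (A B S : Finset V)
    (hS : (G.induce (S : Set V)).Connected) (hSub : S ⊆ A ∪ B)
    (hAB : ∀ a ∈ A, ∀ b ∈ B, ¬ G.Adj a b) : S ⊆ A ∨ S ⊆ B := by
  by_cases h : S ⊆ B
  · exact Or.inr h
  left
  obtain ⟨x, hxS, hxB⟩ := Finset.not_subset.1 h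
  have hxA : x ∈ A := by
    have := hSub hxS
    simp only [Finset.mem_union] at this
    tauto
  by_contra hc
  obtain ⟨y, hyS, hyA⟩ := Finset.not_subset.1 hc
  obtain ⟨p⟩ := hS.preconnected ⟨x, hxS⟩ ⟨y, hyS⟩
  have : ∀ (u w : (S : Set V)) (p : (G.induce (S : Set V)).Walk u w), u.1 ∈ A → w.1 ∈ A := by
    intro u w p
    induction p with
    | nil => exact id
    | @cons a b c hab _ ih =>
      intro ha
      apply ih
      by_contra hb
      have hbS := hSub b.2
      simp only [Finset.mem_union] at hbS
      exact hAB a.1 ha b.1 (by tauto) (by simpa using hab)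
  exact hyA (this _ _ p hxA)

lemma conn_join {V : Type*} [DecidableEq V] (G : SimpleGraph V) (A B S : Finset V)
    (hSub : S ⊆ A ∪ B) (hAB : ∀ a ∈ A, ∀ b ∈ B, G.Adj a b)
    (hA : ¬ S ⊆ A) (hB : ¬ S ⊆ B) : (G.induce (S : Set V)).Connected := by
  obtain ⟨x, hxS, hxB⟩ := Finset.not_subset.1 hB
  obtain ⟨y, hyS, hyA⟩ := Finset.not_subset.1 hA
  have hxA : x ∈ A := by
    have := hSub hxS
    simp only [Finset.mem_union] at this
    tauto
  have hyB : y ∈ B := by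
    have := hSub hyS
    simp only [Finset.mem_union] at this
    tauto
  have key : ∀ z : (S : Set V), (G.induce (S : Set V)).Reachable ⟨x, hxS⟩ z := by
    have hadj : ∀ p q : (S : Set V), p.1 ∈ A → q.1 ∈ B → (G.induce (S : Set V)).Adj p q := by
      intro p q hp hq
      simpa using hAB _ hp _ hq
    intro z
    rcases Finset.mem_union.1 (hSub z.2) with h | h
    · exact (hadj ⟨x, hxS⟩ ⟨y, hyS⟩ hxA hyB).reachable.trans (hadj z ⟨y, hyS⟩ h hyB).reachable.symm
    · exact (hadj ⟨x, hxS⟩ z hxA h).reachable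
  haveI : Nonempty (S : Set V) := ⟨⟨x, hxS⟩⟩
  exact ⟨fun u w => (key u).symm.trans (key w)⟩

lemma conn_single {V : Type*} [Fintype V] (G : SimpleGraph V) (v : V) :
    ({v} : Finset V) ∈ connSets G := by
  rw [mem_connSets]
  refine ⟨by simp, ?_⟩
  haveI : Nonempty (({v} : Finset V) : Set V) := ⟨⟨v, by simp⟩⟩
  refine ⟨fun a b => ?_⟩
  have : a = b := by
    have h1 := a.2
    have h2 := b.2
    ext
    simp at h1 h2
    rw [h1, h2]
  rw [this]

/-- connected subsets of W -/
noncomputable def cs {V : Type*} [Fintype V] [DecidableEq V] (G : SimpleGraph V) (W : Finset V) :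
    Finset (Finset V) := (connSets G).filter (fun S => S ⊆ W)

lemma mem_cs {V : Type*} [Fintype V] [DecidableEq V] (G : SimpleGraph V) (W S : Finset V) :
    S ∈ cs G W ↔ (S.Nonempty ∧ (G.induce (S : Set V)).Connected) ∧ S ⊆ W := by
  simp [cs, mem_connSets]

lemma card_le_cs {V : Type*} [Fintype V] [DecidableEq V] (G : SimpleGraph V) (W : Finset V) :
    W.card ≤ (cs G W).card := by
  refine Finset.card_le_card_of_injOn (fun v => {v}) ?_ ?_
  · intro v hv
    simp only [cs, Finset.coe_filter, Set.mem_setOf_eq]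
    exact ⟨conn_single G v, by simpa using hv⟩
  · intro a _ b _ h
    simpa using h

lemma cs_disj {V : Type*} [Fintype V] [DecidableEq V] (G : SimpleGraph V) (A B : Finset V)
    (hd : Disjoint A B) : Disjoint (cs G A) (cs G B) := by
  rw [Finset.disjoint_left]
  intro S h1 h2
  rw [mem_cs] at h1 h2
  obtain ⟨x, hx⟩ := h1.1.1
  exact Finset.disjoint_left.1 hd (h1.2 hx) (h2.2 hx)

lemma pow_sum {V : Type*} [DecidableEq V] (W : Finset V) (k : ℤ) :
    ∑ S ∈ W.powerset, (2 * (S.card : ℤ) - k) = (W.card - k) * 2 ^ W.card := by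
  induction W using Finset.induction_on generalizing k with
  | empty => simp
  | insert v W hv ih =>
    rw [Finset.sum_powerset_insert hv, ih, Finset.card_insert_of_notMem hv]
    have : ∑ S ∈ W.powerset, (2 * ((insert v S).card : ℤ) - k)
        = ∑ S ∈ W.powerset, (2 * (S.card : ℤ) - (k - 2)) := by
      refine Finset.sum_congr rfl fun S hS => ?_
      rw [Finset.card_insert_of_notMem (fun h => hv (Finset.mem_powerset.1 hS h))]
      push_cast
      ring
    rw [this, ih]
    push_cast
    ring

lemma cross_sum {V : Type*} [DecidableEq V] (A B : Finset V) (hd : Disjoint A B) (k : ℤ) :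
    ∑ S ∈ (A ∪ B).powerset \ (A.powerset ∪ B.powerset), (2 * (S.card : ℤ) - k)
      = (A.card + B.card - k) * 2 ^ (A.card + B.card) - (A.card - k) * 2 ^ A.card
        - (B.card - k) * 2 ^ B.card - k := by
  have h1 : A.powerset ∪ B.powerset ⊆ (A ∪ B).powerset := by
    apply Finset.union_subset <;> apply Finset.powerset_mono.2
    · exact Finset.subset_union_left
    · exact Finset.subset_union_right
  have h2 := Finset.sum_sdiff (f := fun S : Finset V => (2 * (S.card : ℤ) - k)) h1
  have h3 := Finset.sum_union_inter (s₁ := A.powerset) (s₂ := B.powerset)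
    (f := fun S : Finset V => (2 * (S.card : ℤ) - k))
  have h4 : A.powerset ∩ B.powerset = {∅} := by
    ext S
    simp only [Finset.mem_inter, Finset.mem_powerset, Finset.mem_singleton]
    rw [← Finset.subset_inter_iff, Finset.disjoint_iff_inter_eq_empty.1 hd, Finset.subset_empty]
  rw [h4, pow_sum, pow_sum, Finset.sum_singleton] at h3
  rw [pow_sum, Finset.card_union_of_disjoint hd] at h2
  push_cast at h2 h3
  simp only [Finset.card_empty, Nat.cast_zero] at h3
  linarith

lemma cs_join {V : Type*} [Fintype V] [DecidableEq V] (G : SimpleGraph V) (A B : Finset V)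
    (hAB : ∀ a ∈ A, ∀ b ∈ B, G.Adj a b) :
    cs G (A ∪ B) = (cs G A ∪ cs G B) ∪ ((A ∪ B).powerset \ (A.powerset ∪ B.powerset)) := by
  ext S
  simp only [Finset.mem_union, mem_cs, Finset.mem_sdiff, Finset.mem_powerset, not_or]
  constructor
  · rintro ⟨h1, h2⟩
    by_cases h3 : S ⊆ A
    · tauto
    · by_cases h4 : S ⊆ B <;> tauto
  · rintro ((h | h) | h)
    · exact ⟨h.1, h.2.trans Finset.subset_union_left⟩
    · exact ⟨h.1, h.2.trans Finset.subset_union_right⟩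
    · refine ⟨⟨?_, conn_join G A B S h.1 hAB h.2.1 h.2.2⟩, h.1⟩
      rw [Finset.nonempty_iff_ne_empty]
      rintro rfl
      simp at h

lemma cs_split {V : Type*} [Fintype V] [DecidableEq V] (G : SimpleGraph V) (A B : Finset V)
    (hAB : ∀ a ∈ A, ∀ b ∈ B, ¬ G.Adj a b) :
    cs G (A ∪ B) = cs G A ∪ cs G B := by
  ext S
  simp only [Finset.mem_union, mem_cs]
  constructor
  · rintro ⟨h1, h2⟩
    rcases conn_split G A B S h1.2 h2 hAB with h | h <;> tauto
  · rintro (h | h)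
    · exact ⟨h.1, h.2.trans Finset.subset_union_left⟩
    · exact ⟨h.1, h.2.trans Finset.subset_union_right⟩

lemma shift_sum {V : Type*} (C : Finset (Finset V)) (k l : ℤ) :
    ∑ S ∈ C, (2 * (S.card : ℤ) - k) = ∑ S ∈ C, (2 * (S.card : ℤ) - l) - (k - l) * C.card := by
  rw [Finset.sum_sub_distrib, Finset.sum_sub_distrib]
  simp
  ring

lemma main {V : Type*} [Fintype V] [DecidableEq V] (G : SimpleGraph V) (h : P4F G) (n : ℕ) :
    ∀ W : Finset V, W.card = n → W.Nonempty → ∀ s : ℕ, (∀ S ∈ cs G W, S.card ≤ s) →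
    ∑ S ∈ cs G W, (2 * (S.card : ℤ) - (s + 1)) ≤ 0 ∧
    (2 ≤ s → ∑ S ∈ cs G W, (2 * (S.card : ℤ) - (s + 1)) < 0) := by
  induction n using Nat.strong_induction_on with
  | _ n ih =>
  intro W hn hW s hs
  by_cases h2 : 2 ≤ W.card
  · rcases split_or_join G h W h2 with ⟨A, B, hA, hB, hd, rfl, hAB⟩ | ⟨A, B, hA, hB, hd, rfl, hAB⟩
    · rw [Finset.card_union_of_disjoint hd] at hn
      have a0 := hA.card_pos
      have b0 := hB.card_pos
      rw [cs_split G A B hAB] at hs ⊢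
      rw [Finset.sum_union (cs_disj G A B hd)]
      have i1 := ih A.card (by omega) A rfl hA s (fun S hS => hs S (Finset.mem_union_left _ hS))
      have i2 := ih B.card (by omega) B rfl hB s (fun S hS => hs S (Finset.mem_union_right _ hS))
      refine ⟨by linarith [i1.1, i2.1], fun q => by linarith [i1.2 q, i2.2 q]⟩
    · suffices hlt : ∑ S ∈ cs G (A ∪ B), (2 * (S.card : ℤ) - (s + 1)) < 0 from
        ⟨hlt.le, fun _ => hlt⟩
      have a0 := hA.card_pos
      have b0 := hB.card_pos
      have hns : (A ∪ B).card ≤ s := by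
        apply hs
        rw [cs_join G A B hAB]
        refine Finset.mem_union_right _ ?_
        simp only [Finset.mem_sdiff, Finset.mem_powerset, Finset.mem_union, subset_refl, true_and,
          not_or]
        constructor
        · intro hh
          have := Finset.card_le_card hh
          rw [Finset.card_union_of_disjoint hd] at this
          omega
        · intro hh
          have := Finset.card_le_card hh
          rw [Finset.card_union_of_disjoint hd] at this
          omega
      rw [Finset.card_union_of_disjoint hd] at hn hns
      set k : ℤ := A.card + B.card + 1 with hk
      have e1 : ∑ S ∈ cs G (A ∪ B), (2 * (S.card : ℤ) - (s + 1))
          ≤ ∑ S ∈ cs G (A ∪ B), (2 * (S.card : ℤ) - k) := by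
        refine Finset.sum_le_sum fun S _ => ?_
        have : (A.card + B.card : ℤ) ≤ s := by exact_mod_cast hns
        linarith
      refine e1.trans_lt ?_
      have hcl : ∀ (A : Finset V), ∀ S ∈ cs G A, S.card ≤ A.card := fun A S hS =>
        Finset.card_le_card ((mem_cs G A S).1 hS).2
      have i1 := (ih A.card (by omega) A rfl hA A.card (hcl A)).1
      have i2 := (ih B.card (by omega) B rfl hB B.card (hcl B)).1
      rw [cs_join G A B hAB, Finset.sum_union, Finset.sum_union (cs_disj G A B hd),
        cross_sum A B hd, shift_sum (cs G A) k (A.card + 1), shift_sum (cs G B) k (B.card + 1)]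
      · have c1 : (A.card : ℤ) ≤ (cs G A).card := by exact_mod_cast card_le_cs G A
        have c2 : (B.card : ℤ) ≤ (cs G B).card := by exact_mod_cast card_le_cs G B
        have x1 : (A.card : ℤ) + 1 ≤ 2 ^ A.card := by exact_mod_cast Nat.lt_two_pow_self
        have x2 : (B.card : ℤ) + 1 ≤ 2 ^ B.card := by exact_mod_cast Nat.lt_two_pow_self
        have a0' : (0 : ℤ) < A.card := by exact_mod_cast a0
        have b0' : (0 : ℤ) < B.card := by exact_mod_cast b0
        rw [pow_add]
        generalize (A.card : ℤ) = a at *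
        generalize (B.card : ℤ) = b at *
        generalize ((cs G A).card : ℤ) = p at *
        generalize ((cs G B).card : ℤ) = q at *
        generalize (2 : ℤ) ^ A.card = x at *
        generalize (2 : ℤ) ^ B.card = y at *
        rw [hk]
        have m1 := mul_nonneg (sub_nonneg.2 x1) (sub_nonneg.2 x2)
        have m2 := mul_le_mul_of_nonneg_left c1 b0'.le
        have m3 := mul_le_mul_of_nonneg_left c2 a0'.le
        have m4 := mul_pos a0' b0'
        nlinarith
      · rw [Finset.disjoint_left]
        intro S hS hS'
        simp only [Finset.mem_union, mem_cs, Finset.mem_sdiff, Finset.mem_powerset] at hS hS'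
        tauto
  · have hc := hW.card_pos
    obtain ⟨v, rfl⟩ := Finset.card_eq_one.1 (by omega : W.card = 1)
    have hcs : cs G {v} = {{v}} := by
      ext S
      rw [cs, Finset.mem_filter, Finset.mem_singleton]
      constructor
      · rintro ⟨h1, h2⟩
        rcases Finset.subset_singleton_iff.1 h2 with rfl | h3
        · simp [mem_connSets] at h1
        · exact h3
      · rintro rfl
        exact ⟨conn_single G v, subset_refl _⟩
    rw [hcs] at hs ⊢
    have := hs {v} (by simp)
    simp only [Finset.card_singleton] at this
    simp only [Finset.sum_singleton, Finset.card_singleton]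
    refine ⟨by push_cast; omega, fun _ => by push_cast; omega⟩

lemma conn_card {V : Type*} [Fintype V] (G : SimpleGraph V) (s : ℕ)
    (hcomp : ∀ v : V, (G.connectedComponentMk v).supp.ncard ≤ s) (S : Finset V)
    (hS : S ∈ connSets G) : S.card ≤ s := by
  rw [mem_connSets] at hS
  obtain ⟨⟨x, hx⟩, hc⟩ := hS
  refine le_trans ?_ (hcomp x)
  rw [← Set.ncard_coe_finset]
  refine Set.ncard_le_ncard ?_ (Set.toFinite _)
  intro y hy
  rw [SimpleGraph.ConnectedComponent.mem_supp_iff, SimpleGraph.ConnectedComponent.eq]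
  exact (hc.preconnected ⟨y, hy⟩ ⟨x, hx⟩).map (SimpleGraph.Embedding.induce (S : Set V)).toHom

end Stmt11

theorem stmt_11 {V : Type*} [Fintype V] [Nonempty V] (G : SimpleGraph V) (s : ℕ)
    (hcog : IsCograph G)
    (hcomp : ∀ v : V, (G.connectedComponentMk v).supp.ncard ≤ s) :
    globalMean G ≤ ((s : ℝ) + 1) / 2 ∧ (globalMean G = ((s : ℝ) + 1) / 2 ↔ s = 1) := by
  classical
  have hcard := Stmt11.conn_card G s hcomp
  have hcs : Stmt11.cs G Finset.univ = connSets G := by simp [Stmt11.cs]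
  have hm := Stmt11.main G (Stmt11.p4f_of_cograph G hcog) _ Finset.univ rfl Finset.univ_nonempty s
    (by rw [hcs]; exact hcard)
  rw [hcs] at hm
  obtain ⟨v⟩ := ‹Nonempty V›
  have hv := Stmt11.conn_single G v
  have hs1 : 1 ≤ s := by simpa using hcard _ hv
  have hpos : (0 : ℝ) < (connSets G).card := by
    exact_mod_cast Finset.card_pos.2 ⟨_, hv⟩
  have hsum : ((∑ S ∈ connSets G, (2 * (S.card : ℤ) - (s + 1)) : ℤ) : ℝ)
      = 2 * (∑ S ∈ connSets G, (S.card : ℝ)) - (s + 1) * (connSets G).card := by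
    push_cast
    rw [Finset.sum_sub_distrib, ← Finset.mul_sum]
    simp
    ring
  have hle : globalMean G ≤ ((s : ℝ) + 1) / 2 := by
    have h1 : ((∑ S ∈ connSets G, (2 * (S.card : ℤ) - (s + 1)) : ℤ) : ℝ) ≤ 0 := by
      exact_mod_cast hm.1
    rw [globalMean, div_le_iff₀ hpos]
    linarith
  refine ⟨hle, ?_, ?_⟩
  · intro he
    by_contra hne
    have h1 : ((∑ S ∈ connSets G, (2 * (S.card : ℤ) - (s + 1)) : ℤ) : ℝ) < 0 := by
      exact_mod_cast hm.2 (by omega)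
    rw [globalMean, div_eq_iff hpos.ne'] at he
    linarith
  · rintro rfl
    refine le_antisymm hle ?_
    rw [globalMean, le_div_iff₀ hpos]
    have : ∑ S ∈ connSets G, (1 : ℝ) ≤ ∑ S ∈ connSets G, (S.card : ℝ) := by
      refine Finset.sum_le_sum fun S hS => ?_
      exact_mod_cast ((Stmt11.mem_connSets G S).1 hS).1.card_pos
    simp at this ⊢
    linarith
end

section
/- For every n ≥ 3: (a) M_{S_n} = n/2 + 1/(3·2^{n−2}); (b) M_{K_n} = n/2 + n/(2^{n+1}−2); and (c) M_{S_n} < M_{K_n}. -/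
open SimpleGraph Finset

lemma aux_sum {V : Type*} [DecidableEq V] (A : Finset V) :
    ∑ S ∈ A.powerset, (S.card : ℝ) = (A.card : ℝ) * 2 ^ A.card / 2 := by
  induction A using Finset.induction_on with
  | empty => simp
  | insert a A ha ih =>
    rw [Finset.sum_powerset_insert ha]
    have : ∑ t ∈ A.powerset, ((insert a t).card : ℝ) = ∑ t ∈ A.powerset, ((t.card : ℝ) + 1) := by
      apply Finset.sum_congr rfl
      intro t ht
      rw [Finset.card_insert_of_notMem (fun h => ha (Finset.mem_powerset.1 ht h))]
      push_cast; rfl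
    rw [this, Finset.sum_add_distrib, ih, Finset.card_insert_of_notMem ha]
    simp [Finset.card_powerset]
    ring

lemma conn_of_star {V : Type*} (G : SimpleGraph V) (S : Set V) (v : V) (hv : v ∈ S)
    (h : ∀ w ∈ S, w ≠ v → G.Adj v w) : (G.induce S).Connected := by
  rw [SimpleGraph.connected_iff_exists_forall_reachable]
  refine ⟨⟨v, hv⟩, fun ⟨w, hw⟩ => ?_⟩
  by_cases hwv : w = v
  · subst hwv; exact SimpleGraph.Reachable.refl _
  · exact SimpleGraph.Adj.reachable (by simpa using h w hw hwv)

lemma conn_top (n : ℕ) : connSets (⊤ : SimpleGraph (Fin n)) = (univ : Finset (Fin n)).powerset.erase ∅ := by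
  ext S
  simp only [connSets, Set.Finite.mem_toFinset, Set.mem_ofPred_eq, Finset.mem_erase,
    Finset.powerset_univ, Finset.mem_univ, and_true, ← Finset.nonempty_iff_ne_empty]
  refine ⟨fun h => h.1, fun h => ⟨h, ?_⟩⟩
  obtain ⟨v, hv⟩ := h
  exact conn_of_star _ _ v (by simpa using hv) (fun w _ hw => by simpa using hw.symm)

lemma conn_skillet (m : ℕ) (S : Finset (Fin (m+2))) : S ∈ connSets (skillet (m+2)) ↔
    0 ∈ S ∨ S = {1} ∨ (S.Nonempty ∧ ∀ x ∈ S, 2 ≤ (x : ℕ)) := by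
  simp only [connSets, Set.Finite.mem_toFinset, Set.mem_ofPred_eq]
  constructor
  · rintro ⟨hne, hc⟩
    by_cases h0 : 0 ∈ S
    · exact Or.inl h0
    right
    by_cases h1 : 1 ∈ S
    · left
      by_contra hS
      have : ∃ w ∈ S, w ≠ 1 := by
        by_contra! hh
        exact hS (Finset.eq_singleton_iff_unique_mem.2 ⟨h1, hh⟩)
      obtain ⟨w, hw, hw1⟩ := this
      have hnt : Nontrivial (S : Set (Fin (m+2))) :=
        ⟨⟨⟨1, by simpa using h1⟩, ⟨w, by simpa using hw⟩, by simpa using hw1.symm⟩⟩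
      obtain ⟨⟨u, hu⟩, hadj⟩ := hc.preconnected.exists_adj_of_nontrivial ⟨1, by simpa using h1⟩
      have hu' : u ∈ S := by simpa using hu
      have hu0 : (u : ℕ) ≠ 0 := fun h => h0 (by
        have : u = 0 := Fin.ext h
        rwa [← this])
      have hadj2 : (skillet (m+2)).Adj 1 u := hadj
      rw [skillet, SimpleGraph.fromRel_adj] at hadj2
      have e1 : ((1 : Fin (m+2)) : ℕ) = 1 := by simp
      rw [e1] at hadj2
      omega
    · right
      refine ⟨hne, fun x hx => ?_⟩
      have a0 : (x : ℕ) ≠ 0 := fun h => h0 (by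
        have : x = 0 := Fin.ext h
        rwa [← this])
      have a1 : (x : ℕ) ≠ 1 := fun h => h1 (by
        have : x = 1 := Fin.ext (by simpa using h)
        rwa [← this])
      omega
  · rintro (h | h | ⟨⟨v, hv⟩, h⟩)
    · refine ⟨⟨0, h⟩, conn_of_star _ _ 0 (by simpa using h) fun w _ hw => ?_⟩
      simp [skillet, hw.symm]
    · subst h
      refine ⟨by simp, conn_of_star _ _ 1 (by simp) fun w h hw => ?_⟩
      simp at h
      exact absurd h hw
    · refine ⟨⟨v, hv⟩, conn_of_star _ _ v (by simpa using hv) fun w hw' hw => ?_⟩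
      simp [skillet, hw.symm, h v hv, h w (by simpa using hw')]

lemma sum_skillet (m : ℕ) (f : Finset (Fin (m+2)) → ℝ) :
    ∑ S ∈ connSets (skillet (m+2)), f S =
      ∑ S ∈ ((univ : Finset (Fin (m+2))).erase 0).powerset, f (insert 0 S) + f {1} +
      (∑ S ∈ ((univ : Finset (Fin (m+2))).filter (fun x : Fin (m+2) => 2 ≤ (x : ℕ))).powerset, f S - f ∅) := by
  set B := (univ : Finset (Fin (m+2))).filter (fun x : Fin (m+2) => 2 ≤ (x : ℕ)) with hB
  have key : connSets (skillet (m+2)) =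
      ((((univ : Finset (Fin (m+2))).erase 0).powerset.image (insert 0)) ∪ {{1}}) ∪
        B.powerset.erase ∅ := by
    ext S
    rw [conn_skillet]
    simp only [Finset.mem_union, Finset.mem_image, Finset.mem_powerset, Finset.mem_singleton,
      Finset.mem_erase, ← Finset.nonempty_iff_ne_empty, or_assoc]
    refine or_congr ⟨fun h => ⟨S.erase 0, Finset.erase_subset_erase _ (Finset.subset_univ _),
      Finset.insert_erase h⟩, ?_⟩ (or_congr Iff.rfl (and_congr Iff.rfl ?_))
    · rintro ⟨T, _, rfl⟩; simp
    · simp [hB, Finset.subset_iff]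
  rw [key, Finset.sum_union, Finset.sum_union, Finset.sum_image, Finset.sum_singleton]
  · congr 1
    rw [← Finset.sum_erase_add (a := ∅) B.powerset f (by simp)]
    ring
  · intro s hs t ht hst
    have h1 : (0 : Fin (m+2)) ∉ s := fun h => by
      have := (Finset.mem_powerset.1 (Finset.mem_coe.1 hs)) h
      simp at this
    have h2 : (0 : Fin (m+2)) ∉ t := fun h => by
      have := (Finset.mem_powerset.1 (Finset.mem_coe.1 ht)) h
      simp at this
    have := congrArg (fun u => Finset.erase u 0) hst
    simpa [Finset.erase_insert h1, Finset.erase_insert h2] using this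
  · rw [Finset.disjoint_left]
    intro S hS h
    simp only [Finset.mem_image, Finset.mem_singleton] at hS h
    obtain ⟨T, _, rfl⟩ := hS
    have : (0 : Fin (m+2)) ∈ insert 0 T := by simp
    rw [h] at this
    simp at this
  · rw [Finset.disjoint_left]
    intro S hS h
    simp only [Finset.mem_erase, Finset.mem_powerset] at h
    simp only [Finset.mem_union, Finset.mem_image, Finset.mem_singleton] at hS
    rcases hS with ⟨T, _, rfl⟩ | rfl
    · have := h.2 (Finset.mem_insert_self 0 T)
      simp [hB] at this
    · have := h.2 (Finset.mem_singleton_self 1)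
      simp [hB] at this

lemma card_B (m : ℕ) : ((univ : Finset (Fin (m+2))).filter (fun x : Fin (m+2) => 2 ≤ (x : ℕ))).card = m := by
  rw [Finset.card_filter, Fin.sum_univ_succ, Fin.sum_univ_succ]
  simp

lemma mean_skillet (m : ℕ) :
    globalMean (skillet (m+2)) = ((m+2 : ℕ) : ℝ) / 2 + 1 / (3 * 2 ^ m) := by
  have hc : ((connSets (skillet (m+2))).card : ℝ) = 3 * 2 ^ m := by
    have := sum_skillet m (fun _ => 1)
    simp only [Finset.sum_const, Finset.card_powerset, card_B] at this
    simp at this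
    rw [this]; ring
  have hs : ∑ S ∈ connSets (skillet (m+2)), (S.card : ℝ) = 3 * (m+2) * 2 ^ m / 2 + 1 := by
    rw [sum_skillet m (fun S => (S.card : ℝ)), aux_sum, card_B]
    have : ∑ S ∈ ((univ : Finset (Fin (m+2))).erase 0).powerset, ((insert 0 S).card : ℝ)
        = ∑ S ∈ ((univ : Finset (Fin (m+2))).erase 0).powerset, ((S.card : ℝ) + 1) := by
      apply Finset.sum_congr rfl
      intro t ht
      rw [Finset.card_insert_of_notMem (fun h => by
        have := (Finset.mem_powerset.1 ht) h
        simp at this)]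
      push_cast; rfl
    rw [this, Finset.sum_add_distrib, aux_sum]
    simp [Finset.card_powerset]
    ring
  rw [globalMean, hc, hs]
  have : (2 : ℝ) ^ m ≠ 0 := by positivity
  push_cast
  field_simp

lemma mean_top (n : ℕ) (hn : 1 ≤ n) :
    globalMean (⊤ : SimpleGraph (Fin n)) = (n : ℝ) / 2 + (n : ℝ) / (2 ^ (n + 1) - 2) := by
  have hp : (1 : ℝ) < 2 ^ n := one_lt_pow₀ (by norm_num) (by omega)
  have hs : ∑ S ∈ connSets (⊤ : SimpleGraph (Fin n)), (S.card : ℝ) = n * 2 ^ n / 2 := by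
    rw [conn_top]
    have h := Finset.sum_erase_add (a := ∅) (univ : Finset (Fin n)).powerset
      (fun S => (S.card : ℝ)) (by simp)
    rw [aux_sum] at h
    simpa using h
  have hc : ((connSets (⊤ : SimpleGraph (Fin n))).card : ℝ) = 2 ^ n - 1 := by
    rw [conn_top, Finset.card_erase_of_mem (by simp), Finset.card_powerset,
      Nat.cast_sub Nat.one_le_two_pow]
    simp
  rw [globalMean, hc, hs, pow_succ]
  have h1 : (2 : ℝ) ^ n - 1 ≠ 0 := by linarith
  have h2 : (2 : ℝ) ^ n * 2 - 2 = 2 * (2 ^ n - 1) := by ring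
  rw [h2]
  field_simp
  ring

theorem stmt_12 (n : ℕ) (hn : 3 ≤ n) :
    globalMean (skillet n) = (n : ℝ) / 2 + 1 / (3 * 2 ^ (n - 2)) ∧
    globalMean (⊤ : SimpleGraph (Fin n)) = (n : ℝ) / 2 + (n : ℝ) / (2 ^ (n + 1) - 2) ∧
    globalMean (skillet n) < globalMean (⊤ : SimpleGraph (Fin n)) := by
  have ha : globalMean (skillet n) = (n : ℝ) / 2 + 1 / (3 * 2 ^ (n - 2)) := by
    obtain ⟨m, rfl⟩ : ∃ m, n = m + 2 := ⟨n - 2, by omega⟩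
    exact mean_skillet m
  have hb := mean_top n (by omega)
  refine ⟨ha, hb, ?_⟩
  rw [ha, hb]
  obtain ⟨m, rfl⟩ : ∃ m, n = m + 2 := ⟨n - 2, by omega⟩
  have hm : (1 : ℝ) ≤ m := by exact_mod_cast (by omega : 1 ≤ m)
  have hp : (1 : ℝ) ≤ 2 ^ m := one_le_pow₀ (by norm_num)
  have e : (2 : ℝ) ^ (m + 2 + 1) = 8 * 2 ^ m := by ring
  rw [e]
  simp only [Nat.add_sub_cancel]
  push_cast
  apply add_lt_add_right
  rw [div_lt_div_iff₀ (by positivity) (by linarith)]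
  nlinarith
end

section
/- For every n ≥ 2 and every s with 1 ≤ s ≤ n−1, we have M*_{K_{s,n−s}} > n/2. -/
open SimpleGraph Finset

lemma aux_mem (s t : ℕ) (S : Finset (Fin s ⊕ Fin t)) :
    S ∈ mstarSets (completeBipartiteGraph (Fin s) (Fin t)) ↔
      S.toLeft.Nonempty ∧ S.toRight.Nonempty := by
  unfold mstarSets
  rw [Set.Finite.mem_toFinset, Set.mem_ofPred_eq]
  constructor
  · rintro ⟨h2, hc⟩
    have hnt : Nontrivial ((S : Set (Fin s ⊕ Fin t))) := by
      obtain ⟨a, ha, b, hb, hab⟩ := Finset.one_lt_card.1 h2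
      exact ⟨⟨a, ha⟩, ⟨b, hb⟩, fun h => hab (congrArg Subtype.val h)⟩
    obtain ⟨v⟩ := hc.nonempty
    obtain ⟨w, hw⟩ := hc.preconnected.exists_adj_of_nontrivial v
    obtain ⟨v, hv⟩ := v
    obtain ⟨w, hw'⟩ := w
    rcases v with a | a <;> rcases w with b | b <;> simp at hw hv hw'
    · exact ⟨⟨a, by simpa using hv⟩, ⟨b, by simpa using hw'⟩⟩
    · exact ⟨⟨b, by simpa using hw'⟩, ⟨a, by simpa using hv⟩⟩
  · rintro ⟨⟨a, ha⟩, ⟨b, hb⟩⟩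
    rw [Finset.mem_toLeft] at ha
    rw [Finset.mem_toRight] at hb
    refine ⟨Finset.one_lt_card.2 ⟨_, ha, _, hb, by simp⟩, ?_⟩
    have key : ∀ x : (S : Set (Fin s ⊕ Fin t)),
        ((completeBipartiteGraph (Fin s) (Fin t)).induce (S : Set _)).Reachable
          ⟨Sum.inl a, ha⟩ x := by
      have hab : ((completeBipartiteGraph (Fin s) (Fin t)).induce
          (S : Set (Fin s ⊕ Fin t))).Reachable ⟨Sum.inl a, ha⟩ ⟨Sum.inr b, hb⟩ :=
        SimpleGraph.Adj.reachable (by simp)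
      rintro ⟨x | x, hx⟩
      · exact hab.trans (SimpleGraph.Adj.reachable (by simp))
      · exact SimpleGraph.Adj.reachable (by simp)
    have : Nonempty (S : Set (Fin s ⊕ Fin t)) := ⟨⟨_, ha⟩⟩
    exact SimpleGraph.Connected.mk fun x y => (key x).symm.trans (key y)

lemma aux_all (s : ℕ) : ∑ A : Finset (Fin s), (2 * (A.card : ℝ) - s) = 0 := by
  have h : ∑ A : Finset (Fin s), (2 * (A.card : ℝ) - s)
      = ∑ A : Finset (Fin s), -(2 * (A.card : ℝ) - s) := by
    refine Fintype.sum_equiv (Equiv.ofBijective _ compl_bijective) _ _ fun A => ?_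
    have := Finset.card_add_card_compl A
    rw [Fintype.card_fin] at this
    have h' : (A.card : ℝ) + (Aᶜ.card : ℝ) = s := by exact_mod_cast this
    simp only [Equiv.ofBijective_apply]
    linarith
  rw [Finset.sum_neg_distrib] at h
  linarith

lemma aux_ne (s : ℕ) :
    ∑ A : Finset (Fin s) with A.Nonempty, (2 * (A.card : ℝ) - s) = s := by
  have h := aux_all s
  rw [← Finset.sum_filter_add_sum_filter_not _ (fun A : Finset (Fin s) => A.Nonempty)] at h
  have h2 : (univ.filter fun A : Finset (Fin s) => ¬ A.Nonempty) = {∅} := by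
    ext A; simp
  rw [h2, Finset.sum_singleton, Finset.card_empty, Nat.cast_zero] at h
  linarith

lemma aux_pos (s : ℕ) (hs : 1 ≤ s) :
    0 < (((univ : Finset (Finset (Fin s))).filter fun A => A.Nonempty).card : ℝ) := by
  have : 0 < ((univ : Finset (Finset (Fin s))).filter fun A => A.Nonempty).card :=
    Finset.card_pos.2 ⟨{⟨0, hs⟩}, by simp⟩
  exact_mod_cast this

lemma aux_sum_s13 (s t : ℕ) (f : Finset (Fin s) → Finset (Fin t) → ℝ) :
    ∑ S ∈ mstarSets (completeBipartiteGraph (Fin s) (Fin t)), f S.toLeft S.toRight =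
    ∑ A : Finset (Fin s) with A.Nonempty, ∑ B : Finset (Fin t) with B.Nonempty, f A B := by
  rw [← Finset.sum_product']
  refine Finset.sum_bij' (fun S _ => (S.toLeft, S.toRight)) (fun p _ => p.1.disjSum p.2)
    ?_ ?_ ?_ ?_ ?_
  · intro S hS
    simpa using (aux_mem s t S).1 hS
  · intro p hp
    rw [aux_mem]
    simpa using hp
  · intro S _
    exact Finset.toLeft_disjSum_toRight
  · intro p _
    simp
  · intro S _
    rfl

theorem stmt_13 (n s : ℕ) (hn : 2 ≤ n) (hs1 : 1 ≤ s) (hs2 : s ≤ n - 1) :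
    mstarMean (completeBipartiteGraph (Fin s) (Fin (n - s))) > (n : ℝ) / 2 := by
  obtain ⟨t, rfl⟩ : ∃ t, n = s + t := ⟨n - s, by omega⟩
  have ht : 1 ≤ t := by omega
  rw [Nat.add_sub_cancel_left]
  unfold mstarMean
  have hsum := aux_sum_s13 s t fun A B => (2 * (A.card : ℝ) - s) + (2 * (B.card : ℝ) - t)
  have hcard := aux_sum_s13 s t fun A B => 1
  simp only [Finset.sum_add_distrib, Finset.sum_const, ← Finset.mul_sum, aux_ne,
    nsmul_eq_mul, mul_one] at hsum hcard
  have p1 := aux_pos s hs1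
  have p2 := aux_pos t ht
  have hs' : (0 : ℝ) < s := by exact_mod_cast hs1
  have ht' : (0 : ℝ) < t := by exact_mod_cast ht
  have hc : (0 : ℝ) < (mstarSets (completeBipartiteGraph (Fin s) (Fin t))).card := by
    rw [hcard]; positivity
  rw [gt_iff_lt, lt_div_iff₀ hc]
  have e : ∑ S ∈ mstarSets (completeBipartiteGraph (Fin s) (Fin t)),
      (2 * (S.card : ℝ) - (s + t)) > 0 := by
    have e1 : ∑ S ∈ mstarSets (completeBipartiteGraph (Fin s) (Fin t)),
      (2 * (S.card : ℝ) - (s + t)) =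
      ∑ S ∈ mstarSets (completeBipartiteGraph (Fin s) (Fin t)),
      ((2 * (S.toLeft.card : ℝ) - s) + (2 * (S.toRight.card : ℝ) - t)) := by
      refine Finset.sum_congr rfl fun S _ => ?_
      rw [← Finset.card_toLeft_add_card_toRight (u := S)]
      push_cast
      ring
    rw [e1, Finset.sum_add_distrib, hsum]
    positivity
  rw [Finset.sum_sub_distrib, ← Finset.mul_sum, Finset.sum_const, nsmul_eq_mul] at e
  push_cast
  linarith
end
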